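/- For every ε > 0 there exists N(ε) such that: every non-abelian finite simple group G admitting a symmetric generating set S containing the identity with diam_S(G) ≥ |G|^ε satisfies |G| ≤ N(ε). Equivalently, given ε > 0, there are only finitely many non-abelian finite simple groups admitting a symmetric generating set S with diameter diam_S(G) ≥ |G|^ε. -/

import Mathlib

open Pointwise

/-- The diameter of a group `G` with respect to a generating set `S`: the least `n`
such that every element of `G` is a product of `n` elements of `S` (i.e. `Sⁿ = G`),
and `0` if no such `n` exists. -/
noncomputable def groupDiam {G : Type*} [Group G] (S : Set G) : ℕ :=
  sInf {n : ℕ | ∀ g : G, g ∈ S ^ n}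

/-- A multilinear form bounded by `c` on a family of vectors is bounded by `c` times the product of
the `ℓ¹` norms of the coefficients on linear combinations of these vectors. -/
theorem MultilinearMap.abs_map_sum_smul_le {E ι : Type*} [AddCommGroup E] [Module ℝ E] {m : ℕ}
    (ω : MultilinearMap ℝ (fun _ : Fin m => E) ℝ) (Y : Finset ι) (u : ι → E) {c : ℝ}
    (hc : ∀ x : Fin m → ι, (∀ i, x i ∈ Y) → |ω fun i => u (x i)| ≤ c) (κ : Fin m → ι → ℝ) :
    |ω fun i => ∑ y ∈ Y, κ i y • u y| ≤ c * ∏ i, ∑ y ∈ Y, |κ i y| := by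
  rw [MultilinearMap.map_sum_finset, Finset.prod_univ_sum, Finset.mul_sum]
  refine (Finset.abs_sum_le_sum_abs _ _).trans (Finset.sum_le_sum fun x hx => ?_)
  rw [MultilinearMap.map_smul_univ, smul_eq_mul, abs_mul, Finset.abs_prod, mul_comm]
  exact mul_le_mul_of_nonneg_right (hc x fun i => Fintype.mem_piFinset.1 hx i)
    (Finset.prod_nonneg fun i _ => abs_nonneg _)

/-- If each vector of a family is, up to an `ℓ¹`-small combination of the `u y`, one of only `N`
combinations of the `u y`, then alternating forms are small on the family. -/
theorem AlternatingMap.abs_le_of_approx {E ι κ : Type*} [AddCommGroup E] [Module ℝ E] {m N : ℕ}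
    (ω : E [⋀^Fin m]→ₗ[ℝ] ℝ) (Y : Finset ι) (u : ι → E) {c δ : ℝ} (hc0 : 0 ≤ c)
    (hc : ∀ x : Fin m → ι, (∀ i, x i ∈ Y) → |ω fun i => u (x i)| ≤ c)
    (C : Finset κ) (hC : C.card ≤ N) (hN : N ≤ m) (f : κ → ι → ℝ)
    (hf : ∀ k ∈ C, ∑ y ∈ Y, |f k y| ≤ 1) (hδ0 : 0 ≤ δ) (hδ : δ ≤ 1)
    (k : Fin m → κ) (hk : ∀ i, k i ∈ C) (e : Fin m → ι → ℝ)
    (he : ∀ i, ∑ y ∈ Y, |e i y| ≤ δ) :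
    |ω fun i => ∑ y ∈ Y, (f (k i) y + e i y) • u y| ≤ 2 ^ m * δ ^ (m - N) * c := by
  classical
  have hsplit : (fun i => ∑ y ∈ Y, (f (k i) y + e i y) • u y) =
      (fun i => ∑ y ∈ Y, f (k i) y • u y) + fun i => ∑ y ∈ Y, e i y • u y := by
    ext i
    simp only [Pi.add_apply, add_smul, Finset.sum_add_distrib]
  rw [hsplit, ← AlternatingMap.coe_multilinearMap, MultilinearMap.map_add_univ]
  have hterm : ∀ s : Finset (Fin m), |ω.toMultilinearMap (s.piecewise
      (fun i => ∑ y ∈ Y, f (k i) y • u y) fun i => ∑ y ∈ Y, e i y • u y)| ≤ δ ^ (m - N) * c := by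
    intro s
    by_cases hs : s.card ≤ N
    · have h1 : (s.piecewise (fun i => ∑ y ∈ Y, f (k i) y • u y) fun i => ∑ y ∈ Y, e i y • u y) =
          fun i => ∑ y ∈ Y, (if i ∈ s then f (k i) y else e i y) • u y := by
        ext i
        by_cases hi : i ∈ s <;> simp [hi]
      rw [h1]
      refine (MultilinearMap.abs_map_sum_smul_le ω.toMultilinearMap Y u hc _).trans ?_
      rw [mul_comm]
      refine mul_le_mul_of_nonneg_right ?_ hc0
      calc ∏ i, ∑ y ∈ Y, |if i ∈ s then f (k i) y else e i y|
          ≤ ∏ i : Fin m, (if i ∈ s then 1 else δ) := by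
            refine Finset.prod_le_prod (fun i _ => Finset.sum_nonneg fun _ _ => abs_nonneg _)
              fun i _ => ?_
            by_cases hi : i ∈ s
            · simpa [hi] using hf _ (hk i)
            · simpa [hi] using he i
        _ = δ ^ (m - s.card) := by
            rw [Finset.prod_ite]
            simp only [Finset.prod_const_one, one_mul, Finset.prod_const]
            congr 1
            rw [← Finset.compl_filter, Finset.card_compl]
            simp
        _ ≤ δ ^ (m - N) := pow_le_pow_of_le_one hδ0 hδ (by omega)
    · obtain ⟨i, hi, j, hj, hij, hkij⟩ : ∃ i ∈ s, ∃ j ∈ s, i ≠ j ∧ k i = k j :=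
        Finset.exists_ne_map_eq_of_card_lt_of_maps_to (t := C) (by omega) fun i _ => hk i
      rw [AlternatingMap.coe_multilinearMap, AlternatingMap.map_eq_zero_of_eq ω _ _ hij]
      · simpa using mul_nonneg (pow_nonneg hδ0 _) hc0
      · simp [hi, hj, hkij]
  refine (Finset.abs_sum_le_sum_abs _ _).trans ((Finset.sum_le_sum fun s _ => hterm s).trans ?_)
  simp [mul_assoc]

section WordBalls

variable {G : Type*} [Group G] [DecidableEq G] {S : Finset G}

theorem inv_mem_pow_of_symm (hS : S⁻¹ = S) {n : ℕ} {x : G} (hx : x ∈ S ^ n) : x⁻¹ ∈ S ^ n := by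
  have h : (S ^ n)⁻¹ = S ^ n := by rw [← inv_pow, hS]
  rw [← h]
  exact Finset.inv_mem_inv hx

theorem mul_mem_pow_add {n k : ℕ} {x y : G} (hx : x ∈ S ^ n) (hy : y ∈ S ^ k) :
    x * y ∈ S ^ (n + k) := by
  rw [pow_add]
  exact Finset.mul_mem_mul hx hy

theorem mem_pow_of_le (h1 : (1 : G) ∈ S) {n k : ℕ} (h : n ≤ k) {x : G} (hx : x ∈ S ^ n) :
    x ∈ S ^ k := Finset.pow_subset_pow_right h1 h hx

theorem one_mem_pow (h1 : (1 : G) ∈ S) (n : ℕ) : (1 : G) ∈ S ^ n :=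
  mem_pow_of_le h1 (Nat.zero_le n) (by simp)

/-- A ball of radius `ρ` is covered by boundedly many balls of radius `2 * r`. -/
theorem exists_covering_pow (hS : S⁻¹ = S) (h1 : (1 : G) ∈ S) {ρ r K : ℕ}
    (hK : (S ^ (ρ + r)).card ≤ K * (S ^ r).card) :
    ∃ C ⊆ S ^ ρ, C.card ≤ K ∧ ∀ x ∈ S ^ ρ, ∃ c ∈ C, c⁻¹ * x ∈ S ^ (2 * r) := by
  obtain ⟨C, hC, hcard, hcov⟩ := Finset.ruzsa_covering_mul (K := (K : ℝ)) (A := S ^ ρ) (B := S ^ r)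
    ⟨1, one_mem_pow h1 r⟩ (by rw [← pow_add]; exact_mod_cast hK)
  refine ⟨C, hC, by exact_mod_cast hcard, fun x hx => ?_⟩
  obtain ⟨c, hc, d, hd, rfl⟩ := Finset.mem_mul.1 (hcov hx)
  refine ⟨c, hc, ?_⟩
  obtain ⟨a, ha, b, hb, rfl⟩ := Finset.mem_div.1 hd
  rw [inv_mul_cancel_left, two_mul, div_eq_mul_inv]
  exact mul_mem_pow_add ha (inv_mem_pow_of_symm hS hb)

/-- Among the radii `2 * r * i`, one finds a ball with a thin outer shell. -/
theorem exists_thin_shell (h1 : (1 : G) ∈ S) {r I : ℕ} {K δ : ℝ} (hδ : 0 ≤ δ)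
    (hK : ((S ^ (2 * r * (I + 1))).card : ℝ) ≤ K * (S ^ r).card) (hI : K < (1 + δ) ^ I) :
    ∃ ℓ ≤ 2 * r * I, ((S ^ (ℓ + 2 * r)).card : ℝ) ≤ (1 + δ) * (S ^ ℓ).card := by
  by_contra! h
  have hgrow : ∀ i ≤ I, (1 + δ) ^ i * ((S ^ r).card : ℝ) ≤ (S ^ (2 * r * (i + 1))).card := by
    intro i
    induction i with
    | zero =>
      intro _
      simpa using Finset.card_le_card (Finset.pow_subset_pow_right h1 (by omega : r ≤ 2 * r))
    | succ i ih =>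
      intro hi
      have h2 := h (2 * r * (i + 1)) (Nat.mul_le_mul_left _ hi)
      have h3 := mul_le_mul_of_nonneg_left (ih (by omega)) (by linarith : 0 ≤ 1 + δ)
      rw [show 2 * r * (i + 1) + 2 * r = 2 * r * (i + 1 + 1) by ring] at h2
      rw [pow_succ]
      linarith
  have hpos : (0 : ℝ) < (S ^ r).card := by
    exact_mod_cast Finset.card_pos.2 ⟨1, one_mem_pow h1 r⟩
  nlinarith [hgrow I le_rfl]

end WordBalls

section Averaging

variable {G E : Type*} [Group G] [DecidableEq G] [AddCommGroup E] [Module ℝ E]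
  (π : Representation ℝ G E)

/-- The average of the translates of `w` by a finite set. -/
noncomputable def averageTranslates (T : Finset G) (w : E) : E :=
  (T.card : ℝ)⁻¹ • ∑ z ∈ T, π z w

theorem translate_averageTranslates (T Y : Finset G) (w : E) (x : G) (hY : x • T ⊆ Y) :
    π x (averageTranslates π T w) =
      ∑ y ∈ Y, (if y ∈ x • T then (T.card : ℝ)⁻¹ else 0) • π y w := by
  simp only [averageTranslates, map_smul, map_sum, ite_smul, zero_smul]
  rw [← Finset.sum_filter, ← Finset.smul_sum]
  congr 1
  have h : Y.filter (· ∈ x • T) = x • T := by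
    ext y
    simp only [Finset.mem_filter, and_iff_right_iff_imp]
    exact fun hy => hY hy
  rw [h, Finset.smul_finset_def, Finset.sum_image (by simp)]
  simp [map_mul]

/-- Averaging over a ball with a thin shell makes alternating forms on translates small. -/
theorem abs_alternating_averageTranslates_le {S : Finset G} (hS : S⁻¹ = S) (h1 : (1 : G) ∈ S)
    {m N ρ r ℓ : ℕ} {δ c : ℝ} (ω : E [⋀^Fin m]→ₗ[ℝ] ℝ) (w : E) (hc0 : 0 ≤ c) (hN : N ≤ m)
    (hδ0 : 0 ≤ δ) (hδ : 2 * δ ≤ 1)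
    (hcov : (S ^ (ρ + r)).card ≤ N * (S ^ r).card)
    (hshell : ((S ^ (ℓ + 2 * r)).card : ℝ) ≤ (1 + δ) * (S ^ ℓ).card)
    (hc : ∀ x : Fin m → G, (∀ i, x i ∈ S ^ (ρ + ℓ)) → |ω fun i => π (x i) w| ≤ c)
    (x : Fin m → G) (hx : ∀ i, x i ∈ S ^ ρ) :
    |ω fun i => π (x i) (averageTranslates π (S ^ ℓ) w)| ≤ 2 ^ m * (2 * δ) ^ (m - N) * c := by
  obtain ⟨C, hCsub, hCcard, hC⟩ := exists_covering_pow hS h1 hcov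
  choose k hkC hk using fun i => hC (x i) (hx i)
  set B := S ^ ℓ with hB
  have hBpos : (0 : ℝ) < B.card := by exact_mod_cast Finset.card_pos.2 ⟨1, one_mem_pow h1 ℓ⟩
  set p : G → G → ℝ := fun z y => if y ∈ z • B then (B.card : ℝ)⁻¹ else 0 with hp
  have hsub : ∀ z ∈ S ^ ρ, z • B ⊆ S ^ (ρ + ℓ) := by
    intro z hz y hy
    obtain ⟨b, hb, rfl⟩ := Finset.mem_smul_finset.1 hy
    exact mul_mem_pow_add hz hb
  have hdiff : ∀ z z' : G, z⁻¹ * z' ∈ S ^ (2 * r) →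
      (((z' • B) \ (z • B)).card : ℝ) ≤ δ * B.card := by
    intro z z' hz
    have h2 : z⁻¹ • ((z' • B) \ (z • B)) ⊆ S ^ (ℓ + 2 * r) \ B := by
      intro y hy
      obtain ⟨a, ha, rfl⟩ := Finset.mem_smul_finset.1 hy
      obtain ⟨ha1, ha2⟩ := Finset.mem_sdiff.1 ha
      obtain ⟨b, hb, rfl⟩ := Finset.mem_smul_finset.1 ha1
      refine Finset.mem_sdiff.2 ⟨?_, fun hmem => ha2 ?_⟩
      · have := mul_mem_pow_add hz hb
        rw [add_comm]
        simpa [mul_assoc] using this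
      · exact Finset.mem_smul_finset.2 ⟨_, hmem, by simp⟩
    have h3 := Finset.card_le_card h2
    rw [Finset.card_smul_finset, Finset.card_sdiff_of_subset
      (Finset.pow_subset_pow_right h1 (by omega))] at h3
    have h4 : B.card ≤ (S ^ (ℓ + 2 * r)).card :=
      Finset.card_le_card (Finset.pow_subset_pow_right h1 (by omega))
    have h5 : (((z' • B) \ (z • B)).card : ℝ) ≤ (S ^ (ℓ + 2 * r)).card - B.card := by
      rw [← Nat.cast_sub h4]
      exact_mod_cast h3
    linarith
  have hform : (fun i => π (x i) (averageTranslates π B w)) =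
      fun i => ∑ y ∈ S ^ (ρ + ℓ), (p (k i) y + (p (x i) y - p (k i) y)) • π y w := by
    ext i
    rw [translate_averageTranslates π B (S ^ (ρ + ℓ)) w (x i) (hsub _ (hx i))]
    simp [hp]
  rw [hform]
  refine AlternatingMap.abs_le_of_approx ω (S ^ (ρ + ℓ)) (fun y => π y w) hc0 hc C hCcard hN p
    ?_ (by linarith) hδ k hkC _ ?_
  · intro z hz
    have : ∀ y, |p z y| = if y ∈ z • B then (B.card : ℝ)⁻¹ else 0 := by
      intro y
      by_cases hy : y ∈ z • B <;> simp [hp, hy]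
    simp only [this]
    rw [← Finset.sum_filter, Finset.sum_const, nsmul_eq_mul]
    have h2 : ((S ^ (ρ + ℓ)).filter (· ∈ z • B)).card ≤ B.card := by
      rw [← Finset.card_smul_finset z B]
      exact Finset.card_le_card fun y hy => (Finset.mem_filter.1 hy).2
    rw [← div_eq_mul_inv, div_le_one hBpos]
    exact_mod_cast h2
  · intro i
    have habs : ∀ y, |p (x i) y - p (k i) y| ≤
        (if y ∈ (x i • B) \ (k i • B) then (B.card : ℝ)⁻¹ else 0) +
        (if y ∈ (k i • B) \ (x i • B) then (B.card : ℝ)⁻¹ else 0) := by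
      intro y
      by_cases hy : y ∈ x i • B <;> by_cases hy' : y ∈ k i • B <;> simp [hp, hy, hy']
    have hsum : ∀ T : Finset G, ∑ y ∈ S ^ (ρ + ℓ), (if y ∈ T then (B.card : ℝ)⁻¹ else 0) ≤
        T.card * (B.card : ℝ)⁻¹ := by
      intro T
      rw [← Finset.sum_filter, Finset.sum_const, nsmul_eq_mul]
      refine mul_le_mul_of_nonneg_right ?_ (by positivity)
      exact_mod_cast Finset.card_le_card fun y hy => (Finset.mem_filter.1 hy).2
    have hk' : (x i)⁻¹ * k i ∈ S ^ (2 * r) := by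
      simpa using inv_mem_pow_of_symm hS (hk i)
    have hsmall : ∀ t : ℝ, t ≤ δ * B.card → t * (B.card : ℝ)⁻¹ ≤ δ := by
      intro t ht
      rwa [← div_eq_mul_inv, div_le_iff₀ hBpos]
    refine (Finset.sum_le_sum fun y _ => habs y).trans ?_
    rw [Finset.sum_add_distrib]
    linarith [hsum ((x i • B) \ (k i • B)), hsum ((k i • B) \ (x i • B)),
      hsmall _ (hdiff _ _ (hk i)), hsmall _ (hdiff _ _ hk')]

end Averaging

section SmoothWeights

variable {G : Type*} [Group G]

/-- The action of `G` on real functions on `G` by left translation. -/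
def leftTranslation (G : Type*) [Group G] : Representation ℝ G (G → ℝ) where
  toFun x := LinearMap.funLeft ℝ ℝ fun g => x⁻¹ * g
  map_one' := by
    ext f g
    simp [LinearMap.funLeft_apply]
  map_mul' x y := by
    ext f g
    simp [LinearMap.funLeft_apply, mul_assoc]

@[simp] theorem leftTranslation_apply (x : G) (f : G → ℝ) (g : G) :
    leftTranslation G x f g = f (x⁻¹ * g) := rfl

variable [DecidableEq G] {S : Finset G}

/-- Probability weights supported on the ball of radius `ρ`. -/
structure IsBallWeight [Fintype G] (S : Finset G) (ρ : ℕ) (w : G → ℝ) : Prop where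
  nonneg : ∀ g, 0 ≤ w g
  sum_eq_one : ∑ g, w g = 1
  mem_of_ne_zero : ∀ g, w g ≠ 0 → g ∈ S ^ ρ

/-- All minors of size `m` of the matrix `w (x⁻¹ * g)`, with rows indexed by the elements `x` of the
ball of radius `ρ`, are bounded by `c`. -/
def MinorBound (S : Finset G) (m ρ : ℕ) (w : G → ℝ) (c : ℝ) : Prop :=
  ∀ x : Fin m → G, (∀ i, x i ∈ S ^ ρ) → ∀ g : Fin m → G,
    |(Matrix.of fun i j => w ((x i)⁻¹ * g j)).det| ≤ c

theorem MinorBound.mono {m ρ ρ' : ℕ} {w : G → ℝ} {c : ℝ} (h : MinorBound S m ρ w c)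
    (h1 : (1 : G) ∈ S) (hρ : ρ' ≤ ρ) : MinorBound S m ρ' w c :=
  fun x hx g => h x (fun i => mem_pow_of_le h1 hρ (hx i)) g

theorem MinorBound.averageTranslates (hS : S⁻¹ = S) (h1 : (1 : G) ∈ S)
    {m N ρ r ℓ : ℕ} {δ c : ℝ} {w : G → ℝ} (hc0 : 0 ≤ c) (hN : N ≤ m)
    (hδ0 : 0 ≤ δ) (hδ : 2 * δ ≤ 1)
    (hcov : (S ^ (ρ + r)).card ≤ N * (S ^ r).card)
    (hshell : ((S ^ (ℓ + 2 * r)).card : ℝ) ≤ (1 + δ) * (S ^ ℓ).card)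
    (h : MinorBound S m (ρ + ℓ) w c) :
    MinorBound S m ρ (averageTranslates (leftTranslation G) (S ^ ℓ) w)
      (2 ^ m * (2 * δ) ^ (m - N) * c) := by
  intro x hx g
  exact abs_alternating_averageTranslates_le (leftTranslation G) hS h1
    (Matrix.detRowAlternating.compLinearMap (LinearMap.funLeft ℝ ℝ g)) w hc0 hN hδ0 hδ hcov hshell
    (fun y hy => h y hy g) x hx

variable [Fintype G]

theorem IsBallWeight.averageTranslates (h1 : (1 : G) ∈ S) {ρ ℓ : ℕ} {w : G → ℝ}
    (h : IsBallWeight S ρ w) :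
    IsBallWeight S (ℓ + ρ) (averageTranslates (leftTranslation G) (S ^ ℓ) w) := by
  have hpos : (0 : ℝ) < (S ^ ℓ).card := by
    exact_mod_cast Finset.card_pos.2 ⟨1, one_mem_pow h1 ℓ⟩
  have happ : ∀ g, _root_.averageTranslates (leftTranslation G) (S ^ ℓ) w g =
      ((S ^ ℓ).card : ℝ)⁻¹ * ∑ z ∈ S ^ ℓ, w (z⁻¹ * g) := by
    intro g
    simp [_root_.averageTranslates, Finset.sum_apply]
  refine ⟨fun g => ?_, ?_, fun g hg => ?_⟩
  · rw [happ]
    exact mul_nonneg (by positivity) (Finset.sum_nonneg fun z _ => h.nonneg _)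
  · simp only [happ]
    rw [← Finset.mul_sum, Finset.sum_comm]
    have : ∀ z : G, ∑ g, w (z⁻¹ * g) = 1 := fun z => by
      rw [← h.sum_eq_one]
      exact Fintype.sum_equiv (Equiv.mulLeft z⁻¹) _ _ fun g => rfl
    simp [this, hpos.ne']
  · rw [happ] at hg
    obtain ⟨z, hz, hne⟩ := Finset.exists_ne_zero_of_sum_ne_zero (right_ne_zero_of_mul hg)
    simpa using mul_mem_pow_add hz (h.mem_of_ne_zero _ hne)

theorem exists_ballWeight_iterate (hS : S⁻¹ = S) (h1 : (1 : G) ∈ S)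
    {m N ρ r ℓ σ : ℕ} {δ : ℝ} (hN : N ≤ m) (hδ0 : 0 ≤ δ) (hδ : 2 * δ ≤ 1)
    (hshell : ((S ^ (ℓ + 2 * r)).card : ℝ) ≤ (1 + δ) * (S ^ ℓ).card) (q : ℕ)
    (hcov : (S ^ (ρ + q * ℓ + r)).card ≤ N * (S ^ r).card) :
    ∀ (w : G → ℝ) (c : ℝ), 0 ≤ c → IsBallWeight S σ w → MinorBound S m (ρ + q * ℓ) w c →
      ∃ w', IsBallWeight S (σ + q * ℓ) w' ∧
        MinorBound S m ρ w' ((2 ^ m * (2 * δ) ^ (m - N)) ^ q * c) := by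
  induction q generalizing σ with
  | zero =>
    intro w c _ hw hb
    exact ⟨w, by simpa using hw, by simpa using hb⟩
  | succ q ih =>
    intro w c hc hw hb
    have hcov' : (S ^ (ρ + q * ℓ + r)).card ≤ N * (S ^ r).card :=
      (Finset.card_le_card (Finset.pow_subset_pow_right h1 (by rw [add_mul]; omega))).trans hcov
    obtain ⟨w', hw', hb'⟩ := ih (σ := ℓ + σ) hcov' _ (2 ^ m * (2 * δ) ^ (m - N) * c) (by positivity)
      (hw.averageTranslates h1)
      (MinorBound.averageTranslates hS h1 hc hN hδ0 hδ hcov' hshell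
        (hb.mono h1 (by rw [add_mul]; omega)))
    refine ⟨w', ?_, ?_⟩
    · convert hw' using 1
      ring
    · convert hb' using 1
      ring

/-- Under polynomial growth there is a weight all of whose large minors are tiny. -/
theorem exists_ballWeight_minorBound_of_sub_le (hS : S⁻¹ = S) (h1 : (1 : G) ∈ S) {c q I L N : ℕ} {a : ℝ}
    (hq : 1 ≤ q) (hL : L = 2 * q * (I + 1)) (hN : N = L ^ (2 * c)) (ha : 1 ≤ a)
    (hI : (N : ℝ) < (1 + (8 * a)⁻¹) ^ I) (J : ℕ) :
    ∀ k j : ℕ, j + k = J → ∃ (w : G → ℝ) (g b ρ : ℕ), IsBallWeight S ρ w ∧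
      ρ + L ^ (j + 1) ≤ L ^ (J + 1) ∧ g + b = k ∧
      N ^ b * (S ^ L ^ j).card ≤ Fintype.card G ∧
      MinorBound S (2 * N) (L ^ j) w (((a⁻¹) ^ (N * q)) ^ g * (2 * N).factorial) := by
  have hL2 : 2 ≤ L := by rw [hL]; nlinarith
  have ha0 : 0 < a := by linarith
  intro k
  induction k with
  | zero =>
    rintro j rfl
    refine ⟨Pi.single 1 1, 0, 0, 0, ⟨fun g => ?_, by simp, fun g hg => ?_⟩, by simp, rfl,
      by simpa using Finset.card_le_univ _, fun x _ g => ?_⟩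
    · by_cases h : g = 1 <;> simp [h]
    · by_contra h
      exact hg (Pi.single_eq_of_ne (by simpa using h) _)
    · have := Matrix.det_le (abv := AbsoluteValue.abs (S := ℝ)) (x := 1)
        (A := Matrix.of fun i j : Fin (2 * N) => (Pi.single 1 1 : G → ℝ) ((x i)⁻¹ * g j))
        (fun i j => by
          by_cases h : (x i)⁻¹ * g j = 1 <;> simp [Pi.single_apply, h])
      simpa using this
  | succ k ih =>
    intro j hj
    obtain ⟨w, g, b, ρ, hw, hρ, hgb, hcard, hmin⟩ := ih (j + 1) (by omega)
    have hLj : L ^ j ≤ L ^ (j + 1) := Nat.pow_le_pow_right (by omega) (by omega)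
    have hmono : (S ^ L ^ j).card ≤ (S ^ L ^ (j + 1)).card :=
      Finset.card_le_card (Finset.pow_subset_pow_right h1 hLj)
    have hLpow : L ^ (j + 1 + 1) = L * L ^ (j + 1) := by ring
    have hLpow' : L ^ (j + 1) = 2 * q * (I + 1) * L ^ j := by rw [pow_succ, ← hL]; ring
    have h2L : 2 * L ^ (j + 1) ≤ L ^ (j + 1 + 1) := by
      rw [hLpow]
      exact Nat.mul_le_mul_right _ hL2
    by_cases hgood : (S ^ L ^ (j + 1)).card ≤ N * (S ^ L ^ j).card
    · set r := L ^ j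
      have hrad : 2 * r * (I + 1) ≤ L ^ (j + 1) := by
        rw [hLpow']
        nlinarith [Nat.zero_le (r * (I + 1))]
      obtain ⟨ℓ, hℓ, hshell⟩ := exists_thin_shell (S := S) (r := r) (I := I) (K := N)
        (δ := (8 * a)⁻¹) h1 (by positivity) (by
          exact_mod_cast (Finset.card_le_card (Finset.pow_subset_pow_right h1 hrad)).trans hgood) hI
      have hqℓ : r + q * ℓ + r ≤ L ^ (j + 1) := by
        rw [hLpow']
        nlinarith [Nat.mul_le_mul_left q hℓ, Nat.mul_le_mul_right r hq]
      have h8 : 2 * (8 * a)⁻¹ ≤ 1 := by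
        rw [mul_inv, ← mul_assoc]
        have := inv_le_one_of_one_le₀ ha
        linarith
      obtain ⟨w', hw', hmin'⟩ := exists_ballWeight_iterate hS h1 (m := 2 * N) (N := N) (ρ := r)
        (by omega) (by positivity) h8 hshell q
        ((Finset.card_le_card (Finset.pow_subset_pow_right h1 hqℓ)).trans hgood) w _
        (by positivity) hw (hmin.mono h1 (by omega))
      refine ⟨w', g + 1, b, ρ + q * ℓ, hw', by omega, by omega,
        (Nat.mul_le_mul_left _ hmono).trans hcard, ?_⟩
      convert hmin' using 1
      have : 2 * N - N = N := by omega
      have h3 : (2 : ℝ) ^ (2 * N) * (2 * (8 * a)⁻¹) ^ N = a⁻¹ ^ N := by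
        rw [pow_mul, ← mul_pow]
        congr 1
        rw [mul_inv]
        ring
      rw [this, h3, pow_succ, pow_mul]
      ring
    · refine ⟨w, g, b + 1, ρ, hw, by omega, by omega, ?_, hmin.mono h1 hLj⟩
      rw [pow_succ, mul_assoc]
      exact (Nat.mul_le_mul_left _ (not_le.1 hgood).le).trans hcard

theorem exists_ballWeight_minorBound (hS : S⁻¹ = S) (h1 : (1 : G) ∈ S) {c q I L N n : ℕ} {a : ℝ}
    (hc : 1 ≤ c) (hq : 1 ≤ q) (hL : L = 2 * q * (I + 1)) (hN : N = L ^ (2 * c)) (ha : 1 ≤ a)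
    (hI : (N : ℝ) < (1 + (8 * a)⁻¹) ^ I) (hG : Fintype.card G ≤ L ^ (c * n)) :
    ∃ (w : G → ℝ) (g : ℕ), n ≤ 2 * g ∧ IsBallWeight S (L ^ (2 * n + 1)) w ∧
      MinorBound S (2 * N) (L ^ n) w (((a⁻¹) ^ (N * q)) ^ g * (2 * N).factorial) := by
  obtain ⟨w, g, b, ρ, hw, hρ, hgb, hcard, hmin⟩ :=
    exists_ballWeight_minorBound_of_sub_le hS h1 hq hL hN ha hI (2 * n) n n (by omega)
  refine ⟨w, g, ?_, ⟨hw.1, hw.2, fun x hx => mem_pow_of_le h1 (by omega) (hw.3 x hx)⟩, hmin⟩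
  have hL2 : 1 < L := by rw [hL]; nlinarith
  have h2 : N ^ b ≤ L ^ (c * n) :=
    ((Nat.le_mul_of_pos_right _ (Finset.card_pos.2 ⟨1, one_mem_pow h1 _⟩)).trans hcard).trans hG
  rw [hN, ← pow_mul, Nat.pow_le_pow_iff_right hL2] at h2
  have : 2 * b ≤ n := Nat.le_of_mul_le_mul_left (by linarith : c * (2 * b) ≤ c * n) hc
  omega

end SmoothWeights

section ApproximateBasis

/-- The Schur complement of one row and one column, written with the coefficients of Cramer's
rule. -/
theorem abs_sub_sum_cramer_eq {α β : Type*} {m : ℕ} (k : α → β → ℝ) (x : Fin m → α) (g : Fin m → β)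
    (y : α) (h : β) (hdet : (Matrix.of fun i j => k (x i) (g j)).det ≠ 0) :
    |k y h - ∑ i, ((Matrix.of fun i' j => k (Function.update x i y i') (g j)).det /
        (Matrix.of fun i j => k (x i) (g j)).det) * k (x i) h| =
      |(Matrix.of fun i j => k ((Fin.append x ![y] : Fin (m + 1) → α) i)
        ((Fin.append g ![h] : Fin (m + 1) → β) j)).det| /
        |(Matrix.of fun i j => k (x i) (g j)).det| := by
  set A : Matrix (Fin m) (Fin m) ℝ := Matrix.of fun i j => k (x i) (g j) with hA
  let _ : Invertible A := A.invertibleOfIsUnitDet (isUnit_iff_ne_zero.2 hdet)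
  set row : Fin m → ℝ := fun j => k y (g j) with hrow
  have hupd : ∀ i, (Matrix.of fun i' j => k (Function.update x i y i') (g j)) =
      A.updateRow i row := by
    intro i
    ext i' j
    by_cases hi : i' = i
    · subst hi
      simp [hrow]
    · simp [hA, hi]
  have hblock : (Matrix.of fun i j => k ((Fin.append x ![y] : Fin (m + 1) → α) i)
      ((Fin.append g ![h] : Fin (m + 1) → β) j)).det =
      (Matrix.fromBlocks A (Matrix.of fun i (_ : Fin 1) => k (x i) h)
        (Matrix.of fun (_ : Fin 1) j => row j) (Matrix.of fun (_ _ : Fin 1) => k y h)).det := by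
    rw [← Matrix.det_submatrix_equiv_self (finSumFinEquiv : Fin m ⊕ Fin 1 ≃ Fin (m + 1))]
    congr 1
    ext i j
    rcases i with i | i <;> rcases j with j | j <;>
      simp [hA, hrow]
  have hcoef : ∀ i, (A.updateRow i row).det / A.det = (Matrix.vecMul row (⅟A)) i := by
    intro i
    have h1 : A.det • Matrix.vecMul row (⅟A) = A.transpose.cramer row := by
      rw [Matrix.invOf_eq_nonsing_inv]
      exact Matrix.det_smul_inv_vecMul_eq_cramer_transpose A row (isUnit_iff_ne_zero.2 hdet)
    have h2 := congrFun h1 i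
    rw [Matrix.cramer_transpose_apply, Pi.smul_apply, smul_eq_mul] at h2
    rw [← h2]
    field_simp
  rw [hblock, Matrix.det_fromBlocks₁₁, abs_mul, mul_div_cancel_left₀ _ (abs_ne_zero.2 hdet)]
  congr 1
  simp only [hupd, hcoef]
  rw [Matrix.det_fin_one]
  simp only [Matrix.sub_apply, Matrix.of_apply, Matrix.mul_apply, Matrix.vecMul, dotProduct]

/-- A pigeonhole over scales for a monotone family of volumes: at some scale both the volume and the
next volume are under control. -/
theorem exists_stable_scale {V : ℕ → ℕ → ℝ} (hmono : ∀ m, Monotone (V m)) (hV0 : ∀ t, V 0 t = 1)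
    {m₀ n : ℕ} {F τ K : ℝ} (hF : 1 ≤ F) (hup : ∀ m ≤ m₀, ∀ t, V m t ≤ F) (hτ0 : 0 < τ) (hτ : τ ≤ 1)
    (hn : 1 ≤ n) (hK : 1 ≤ K) (hlast : ∀ t ≤ 2 * n, V m₀ t < τ ^ m₀)
    (hKn : (F * (τ⁻¹) ^ m₀) ^ (m₀ + 1) ≤ K ^ n) :
    ∃ t m, n ≤ t ∧ t < 2 * n ∧ m < m₀ ∧ 0 < V m t ∧ V m (t + 1) ≤ K * V m t ∧
      V (m + 1) (t + 1) ≤ K * τ * V m t := by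
  set f : ℕ → ℕ → ℝ := fun m t => max (V m t) (τ ^ m) with hf
  have hfpos : ∀ m t, 0 < f m t := fun m t => lt_max_of_lt_right (by positivity)
  have hfmono : ∀ m t, f m t ≤ f m (t + 1) := fun m t =>
    max_le_max_right _ (hmono m (Nat.le_succ t))
  set Ψ : ℕ → ℝ := fun t => ∏ m ∈ Finset.range (m₀ + 1), f m t with hΨ
  have hΨpos : ∀ t, 0 < Ψ t := fun t => Finset.prod_pos fun m _ => hfpos m t
  obtain ⟨t, ht1, ht2, ht⟩ : ∃ t, n ≤ t ∧ t < 2 * n ∧ Ψ (t + 1) ≤ K * Ψ t := by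
    by_contra! hcon
    have hgrow : ∀ i ≤ n, K ^ i * Ψ n ≤ Ψ (n + i) ∧ (1 ≤ i → K ^ i * Ψ n < Ψ (n + i)) := by
      intro i
      induction i with
      | zero => simp
      | succ i ih =>
        intro hi
        have h1 := (ih (by omega)).1
        have h2 := hcon (n + i) (by omega) (by omega)
        have h3 := mul_le_mul_of_nonneg_left h1 (by linarith : 0 ≤ K)
        have h4 : K ^ (i + 1) * Ψ n < Ψ (n + (i + 1)) := by
          rw [pow_succ, ← add_assoc]
          linarith
        exact ⟨h4.le, fun _ => h4⟩
    have h1 := (hgrow n le_rfl).2 hn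
    have h2 : Ψ (n + n) ≤ F ^ (m₀ + 1) := by
      calc Ψ (n + n) ≤ ∏ m ∈ Finset.range (m₀ + 1), F :=
            Finset.prod_le_prod (fun m _ => (hfpos m _).le) fun m hm => max_le
              (hup m (by simpa [Nat.lt_succ_iff] using hm) _)
              ((pow_le_one₀ hτ0.le hτ).trans hF)
        _ = F ^ (m₀ + 1) := by simp
    have h3 : (τ ^ m₀) ^ (m₀ + 1) ≤ Ψ n := by
      calc (τ ^ m₀) ^ (m₀ + 1) = ∏ m ∈ Finset.range (m₀ + 1), τ ^ m₀ := by simp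
        _ ≤ Ψ n := Finset.prod_le_prod (fun m _ => by positivity) fun m hm =>
            (pow_le_pow_of_le_one hτ0.le hτ (by simpa [Nat.lt_succ_iff] using hm)).trans
              (le_max_right _ _)
    have h4 : F ^ (m₀ + 1) = (F * (τ⁻¹) ^ m₀) ^ (m₀ + 1) * (τ ^ m₀) ^ (m₀ + 1) := by
      rw [← mul_pow, mul_assoc, ← mul_pow, inv_mul_cancel₀ hτ0.ne', one_pow, mul_one]
    have h5 : (F * (τ⁻¹) ^ m₀) ^ (m₀ + 1) * (τ ^ m₀) ^ (m₀ + 1) ≤ K ^ n * Ψ n :=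
      mul_le_mul hKn h3 (by positivity) (by positivity)
    linarith
  have hfac : ∀ m ≤ m₀, f m (t + 1) ≤ K * f m t := by
    intro m hm
    have hmem : m ∈ Finset.range (m₀ + 1) := by simpa [Nat.lt_succ_iff] using hm
    simp only [hΨ] at ht
    rw [← Finset.mul_prod_erase _ _ hmem, ← Finset.mul_prod_erase _ (fun m => f m t) hmem] at ht
    set P := ∏ x ∈ (Finset.range (m₀ + 1)).erase m, f x (t + 1)
    have hP : 0 < P := Finset.prod_pos fun x _ => hfpos x _
    have hP' : ∏ x ∈ (Finset.range (m₀ + 1)).erase m, f x t ≤ P :=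
      Finset.prod_le_prod (fun x _ => (hfpos x _).le) fun x _ => hfmono x t
    refine le_of_mul_le_mul_right (a := P) ?_ hP
    calc f m (t + 1) * P ≤ _ := ht
      _ ≤ K * (f m t * P) := by
        have := hfpos m t
        gcongr
      _ = K * f m t * P := by ring
  obtain ⟨m, hm, hge, hlt⟩ : ∃ m < m₀, τ ^ m ≤ V m t ∧ V (m + 1) t < τ ^ (m + 1) := by
    by_contra! hcon
    have : ∀ m ≤ m₀, τ ^ m ≤ V m t := by
      intro m
      induction m with
      | zero => simp [hV0]
      | succ m ih => exact fun hm => hcon m (by omega) (ih (by omega))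
    exact absurd (hlast t ht2.le) (not_lt.2 (this m₀ le_rfl))
  refine ⟨t, m, ht1, ht2, hm, lt_of_lt_of_le (by positivity) hge, ?_, ?_⟩
  · have := hfac m hm.le
    simp only [hf] at this
    rw [max_eq_left hge] at this
    exact (le_max_left _ _).trans this
  · have := hfac (m + 1) hm
    simp only [hf] at this
    rw [max_eq_right hlt.le] at this
    refine ((le_max_left _ _).trans this).trans ?_
    rw [pow_succ, mul_assoc, mul_comm (τ ^ m)]
    gcongr

/-- `u` is within `e` of a combination of the vectors `b i` with coefficients bounded by `a`. -/
def NearSpan {E : Type*} [NormedAddCommGroup E] [NormedSpace ℝ E] {m : ℕ} (b : Fin m → E)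
    (a e : ℝ) (u : E) : Prop :=
  ∃ c : Fin m → ℝ, (∀ i, |c i| ≤ a) ∧ ‖u - ∑ i, c i • b i‖ ≤ e

variable {G : Type*} [Group G] [DecidableEq G] [Fintype G] {S : Finset G}

/-- The largest minor of size `m` of the matrix `w (x⁻¹ * g)`, with rows indexed by the elements `x`
of the ball of radius `ρ`. -/
noncomputable def maxMinor (S : Finset G) (w : G → ℝ) (m ρ : ℕ) : ℝ :=
  ⨆ p : {x : Fin m → G // ∀ i, x i ∈ S ^ ρ} × (Fin m → G),
    |(Matrix.of fun i j => w ((p.1.1 i)⁻¹ * p.2 j)).det|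

theorem minorBound_maxMinor (w : G → ℝ) (m ρ : ℕ) :
    MinorBound S m ρ w (maxMinor S w m ρ) := fun x hx g =>
  le_ciSup (f := fun p : {x : Fin m → G // ∀ i, x i ∈ S ^ ρ} × (Fin m → G) =>
    |(Matrix.of fun i j => w ((p.1.1 i)⁻¹ * p.2 j)).det|) (Set.finite_range _).bddAbove (⟨x, hx⟩, g)

theorem exists_eq_maxMinor (h1 : (1 : G) ∈ S) (w : G → ℝ) (m ρ : ℕ) :
    ∃ x : Fin m → G, (∀ i, x i ∈ S ^ ρ) ∧ ∃ g : Fin m → G,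
      |(Matrix.of fun i j => w ((x i)⁻¹ * g j)).det| = maxMinor S w m ρ := by
  have : Nonempty {x : Fin m → G // ∀ i, x i ∈ S ^ ρ} := ⟨⟨fun _ => 1, fun _ => one_mem_pow h1 _⟩⟩
  obtain ⟨p, hp⟩ := exists_eq_ciSup_of_finite
    (f := fun p : {x : Fin m → G // ∀ i, x i ∈ S ^ ρ} × (Fin m → G) =>
      |(Matrix.of fun i j => w ((p.1.1 i)⁻¹ * p.2 j)).det|)
  exact ⟨p.1.1, p.1.2, p.2, hp⟩

theorem MinorBound.maxMinor_le (h1 : (1 : G) ∈ S) {w : G → ℝ} {m ρ : ℕ} {c : ℝ}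
    (h : MinorBound S m ρ w c) : maxMinor S w m ρ ≤ c := by
  obtain ⟨x, hx, g, hg⟩ := exists_eq_maxMinor h1 w m ρ
  exact hg ▸ h x hx g

theorem IsBallWeight.abs_le_one {ρ : ℕ} {w : G → ℝ} (h : IsBallWeight S ρ w) (g : G) :
    |w g| ≤ 1 := by
  rw [abs_of_nonneg (h.nonneg g), ← h.sum_eq_one]
  exact Finset.single_le_sum (fun g _ => h.nonneg g) (Finset.mem_univ g)

/-- If all large minors of `w` are tiny, then at some scale the translates of `w` are nearly spanned,
with bounded coefficients, by boundedly many of them. -/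
theorem exists_approximate_basis (h1 : (1 : G) ∈ S) {ρ : ℕ} {w : G → ℝ} (hw : IsBallWeight S ρ w)
    {m₀ n R : ℕ} {τ K : ℝ} (hτ0 : 0 < τ) (hτ : τ ≤ 1) (hn : 1 ≤ n) (hK : 1 ≤ K)
    (hR : 2 ^ (2 * n) ≤ R) {c : ℝ} (hmin : MinorBound S m₀ R w c) (hc : c < τ ^ m₀)
    (hKn : ((m₀.factorial : ℝ) * (τ⁻¹) ^ m₀) ^ (m₀ + 1) ≤ K ^ n) :
    ∃ r ≥ 2 ^ n, ∃ m < m₀, ∃ b : Fin m → G → ℝ, (∀ i, ‖b i‖ ≤ 1) ∧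
      (∀ y ∈ S ^ r, ∀ i, NearSpan b K (K * τ) (leftTranslation G y (b i))) ∧
      NearSpan b K (K * τ) w := by
  obtain ⟨t, m, ht, -, hm, hpos, hst, hst'⟩ := exists_stable_scale
    (V := fun m t => maxMinor S w m (2 ^ t)) (m₀ := m₀) (n := n) (F := m₀.factorial) (τ := τ) (K := K)
    (fun m t t' htt' => ((minorBound_maxMinor w m _).mono h1
      (Nat.pow_le_pow_right (by norm_num) htt')).maxMinor_le h1)
    (fun t => by
      obtain ⟨x, -, g, hg⟩ := exists_eq_maxMinor h1 w 0 (2 ^ t)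
      rw [← hg]
      simp)
    (by exact_mod_cast Nat.one_le_of_lt (Nat.factorial_pos m₀))
    (fun m hm t => by
      obtain ⟨x, -, g, hg⟩ := exists_eq_maxMinor h1 w m (2 ^ t)
      rw [← hg]
      have := Matrix.det_le (abv := AbsoluteValue.abs (S := ℝ)) (x := 1)
        (A := Matrix.of fun i j : Fin m => w ((x i)⁻¹ * g j)) (fun i j => hw.abs_le_one _)
      have h2 : ((m.factorial : ℕ) : ℝ) ≤ m₀.factorial := by exact_mod_cast Nat.factorial_le hm
      simp at this
      linarith)
    hτ0 hτ hn hK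
    (fun t ht => ((hmin.mono h1 ((Nat.pow_le_pow_right (by norm_num) ht).trans hR)).maxMinor_le
      h1).trans_lt hc) hKn
  obtain ⟨x, hx, g, hg⟩ := exists_eq_maxMinor h1 w m (2 ^ t)
  set d := (Matrix.of fun i j => w ((x i)⁻¹ * g j)).det with hd
  rw [← hg] at hpos hst hst'
  have hx' : ∀ i, x i ∈ S ^ 2 ^ (t + 1) := fun i =>
    mem_pow_of_le h1 (Nat.pow_le_pow_right (by norm_num) t.le_succ) (hx i)
  have key : ∀ y ∈ S ^ 2 ^ (t + 1),
      NearSpan (fun i => leftTranslation G (x i) w) K (K * τ) (leftTranslation G y w) := by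
    intro y hy
    refine ⟨fun i => (Matrix.of fun i' j => w ((Function.update x i y i')⁻¹ * g j)).det / d,
      fun i => ?_, ?_⟩
    · rw [abs_div, div_le_iff₀ hpos]
      refine (minorBound_maxMinor w m (2 ^ (t + 1)) _ (fun i' => ?_) g).trans hst
      by_cases hi : i' = i
      · subst hi
        simpa using hy
      · simpa [hi] using hx' i'
    · refine (pi_norm_le_iff_of_nonneg (by positivity)).2 fun h => ?_
      have := abs_sub_sum_cramer_eq (fun (y h : G) => w (y⁻¹ * h)) x g y h (abs_pos.1 hpos)
      simp only [Pi.sub_apply, Finset.sum_apply, Pi.smul_apply, smul_eq_mul, Real.norm_eq_abs,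
        leftTranslation_apply]
      rw [hd, this, ← hd, div_le_iff₀ hpos]
      refine (minorBound_maxMinor w (m + 1) (2 ^ (t + 1)) _ (fun i => ?_) _).trans hst'
      refine Fin.addCases (fun i => ?_) (fun i => ?_) i
      · simpa using hx' i
      · simpa using hy
  refine ⟨2 ^ t, Nat.pow_le_pow_right (by norm_num) ht, m, hm,
    fun i => leftTranslation G (x i) w, fun i => ?_, fun y hy i => ?_, ?_⟩
  · exact (pi_norm_le_iff_of_nonneg zero_le_one).2 fun h => hw.abs_le_one _
  · have := key (y * x i) (by
      rw [pow_succ, mul_two]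
      exact mul_mem_pow_add hy (hx i))
    rwa [map_mul] at this
  · simpa using key 1 (one_mem_pow h1 _)

end ApproximateBasis

section Generation

variable {G : Type*} [Group G]

/-- In a finite simple group, a proper subgroup of index at most `Q` forces `|G| ≤ Q!`. -/
theorem Subgroup.eq_top_of_index_le [Finite G] [IsSimpleGroup G] {H : Subgroup G} {Q : ℕ}
    (hH : H.index ≤ Q) (hG : Q.factorial < Nat.card G) : H = ⊤ := by
  rcases (inferInstance : H.normalCore.Normal).eq_bot_or_eq_top with h | h
  · have h1 : Nat.card G ∣ H.index.factorial := by
      have : H.normalCore.index ∣ H.index.factorial := by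
        rw [Subgroup.normalCore_eq_ker, Subgroup.index_ker, Subgroup.index, ← Nat.card_perm]
        exact Subgroup.card_subgroup_dvd_card _
      rwa [h, Subgroup.index_bot] at this
    exact absurd (Nat.le_of_dvd (Nat.factorial_pos _) h1)
      (not_le.2 ((Nat.factorial_le hH).trans_lt hG))
  · exact top_le_iff.1 (h ▸ H.normalCore_le)

/-- Orbits of balls grow by at least one at every step until they are everything. -/
theorem lt_card_image_smul_or_eq_univ [DecidableEq G] {X : Type*} [MulAction G X]
    [MulAction.IsPretransitive G X] [Fintype X] [DecidableEq X] {S : Finset G} (h1 : (1 : G) ∈ S)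
    (hgen : Subgroup.closure (S : Set G) = ⊤) (x : X) (n : ℕ) :
    n < ((S ^ n).image (· • x)).card ∨ (S ^ n).image (· • x) = Finset.univ := by
  induction n with
  | zero => simp
  | succ n ih =>
    have hsub : (S ^ n).image (· • x) ⊆ (S ^ (n + 1)).image (· • x) :=
      Finset.image_subset_image (Finset.pow_subset_pow_right h1 n.le_succ)
    rcases ih with ih | ih
    · by_cases heq : (S ^ n).image (· • x) = (S ^ (n + 1)).image (· • x)
      · right
        rw [← heq]
        set A := (S ^ n).image (· • x) with hA
        have hstab : Subgroup.closure (S : Set G) ≤ MulAction.stabilizer G A := by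
          rw [Subgroup.closure_le]
          intro s hs
          rw [SetLike.mem_coe, MulAction.mem_stabilizer_iff]
          refine Finset.eq_of_subset_of_card_le (fun y hy => ?_)
            (Finset.card_smul_finset s A).ge
          obtain ⟨z, hz, rfl⟩ := Finset.mem_smul_finset.1 hy
          obtain ⟨g, hg, rfl⟩ := Finset.mem_image.1 hz
          rw [heq, Finset.mem_image]
          refine ⟨s * g, ?_, mul_smul _ _ _⟩
          rw [pow_succ']
          exact Finset.mul_mem_mul hs hg
        rw [hgen, top_le_iff] at hstab
        refine Finset.eq_univ_of_forall fun y => ?_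
        obtain ⟨g, rfl⟩ := MulAction.exists_smul_eq G x y
        have hg : g • A = A := by
          rw [← MulAction.mem_stabilizer_iff, hstab]
          trivial
        rw [← hg, Finset.smul_mem_smul_finset_iff]
        exact Finset.mem_image.2 ⟨1, one_mem_pow h1 n, one_smul _ _⟩
      · left
        have := Finset.card_lt_card (hsub.ssubset_of_ne heq)
        omega
    · exact Or.inr (Finset.univ_subset_iff.1 (ih ▸ hsub))

/-- If the points of a ball fall into at most `Q` classes and differences within a class lie in
`H`, then `H` has index at most `Q`. -/
theorem Subgroup.index_le_of_maps_to [DecidableEq G] [Finite G] {S : Finset G} (h1 : (1 : G) ∈ S)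
    (hgen : Subgroup.closure (S : Set G) = ⊤) {H : Subgroup G} {ι : Type*} {Q : ℕ} (t : Finset ι)
    (ht : t.card ≤ Q) (f : G → ι) (hft : ∀ x ∈ S ^ Q, f x ∈ t)
    (hf : ∀ x ∈ S ^ Q, ∀ y ∈ S ^ Q, f x = f y → x⁻¹ * y ∈ H) : H.index ≤ Q := by
  classical
  have := Fintype.ofFinite (G ⧸ H)
  have hle : ((S ^ Q).image (· • ((1 : G) : G ⧸ H))).card ≤ Q := by
    refine le_trans ?_ ht
    have hex : ∀ q ∈ (S ^ Q).image (· • ((1 : G) : G ⧸ H)), ∃ x ∈ S ^ Q, (x : G ⧸ H) = q := by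
      intro q hq
      obtain ⟨x, hx, rfl⟩ := Finset.mem_image.1 hq
      exact ⟨x, hx, by simp [MulAction.Quotient.smul_mk]⟩
    choose! p hp hpq using hex
    refine Finset.card_le_card_of_injOn (fun q => f (p q)) (fun q hq => hft _ (hp q hq)) ?_
    intro q hq q' hq' h
    rw [← hpq q hq, ← hpq q' hq']
    exact QuotientGroup.eq.2 (hf _ (hp q hq) _ (hp q' hq') h)
  rcases lt_card_image_smul_or_eq_univ h1 hgen ((1 : G) : G ⧸ H) Q with h | h
  · omega
  · rw [h, Finset.card_univ, ← Nat.card_eq_fintype_card] at hle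
    exact hle

theorem pow_card_eq_univ_of_closure_eq_top [DecidableEq G] [Fintype G] {S : Finset G}
    (h1 : (1 : G) ∈ S) (hgen : Subgroup.closure (S : Set G) = ⊤) :
    S ^ Fintype.card G = Finset.univ := by
  rcases lt_card_image_smul_or_eq_univ h1 hgen (1 : G) (Fintype.card G) with h | h
  · exact absurd (Finset.card_le_univ _) (not_le.2 h)
  · simpa using h

/-- The subgroup generated by the conjugates, by elements of the ball of radius `n`, of commutators
of elements of `T`. -/
def conjCommutator [DecidableEq G] (S : Finset G) (T : Set G) (n : ℕ) : Subgroup G :=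
  Subgroup.closure {x | ∃ g ∈ S ^ n, ∃ s ∈ T, ∃ t ∈ T, x = g * (s * t * s⁻¹ * t⁻¹) * g⁻¹}

theorem conjCommutator_mono [DecidableEq G] {S : Finset G} (h1 : (1 : G) ∈ S) (T : Set G) (n : ℕ) :
    conjCommutator S T n ≤ conjCommutator S T (n + 1) := by
  refine Subgroup.closure_mono ?_
  rintro x ⟨g, hg, s, hs, t, ht, rfl⟩
  exact ⟨g, mem_pow_of_le h1 n.le_succ hg, s, hs, t, ht, rfl⟩

theorem conj_mem_conjCommutator [DecidableEq G] {S : Finset G} {T : Set G} {n : ℕ} {a x : G}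
    (ha : a ∈ S) (hx : x ∈ conjCommutator S T n) : a * x * a⁻¹ ∈ conjCommutator S T (n + 1) := by
  have : conjCommutator S T n ≤ (conjCommutator S T (n + 1)).comap (MulAut.conj a).toMonoidHom := by
    refine (Subgroup.closure_le _).2 ?_
    rintro x ⟨g, hg, s, hs, t, ht, rfl⟩
    refine Subgroup.subset_closure ⟨a * g, ?_, s, hs, t, ht, ?_⟩
    · rw [pow_succ']
      exact Finset.mul_mem_mul ha hg
    · simp [mul_assoc]
  simpa using this hx

/-- In a non-abelian simple group, boundedly conjugated commutators of generators generate. -/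
theorem conjCommutator_eq_top [DecidableEq G] [Finite G] [IsSimpleGroup G] {S : Finset G}
    (hS : S⁻¹ = S) (h1 : (1 : G) ∈ S) (hgen : Subgroup.closure (S : Set G) = ⊤)
    (hG : ∃ a b : G, a * b ≠ b * a) {T : Set G} (hT : Subgroup.closure T = ⊤) {ℓ : ℕ}
    (hℓ : Nat.card G < 2 ^ ℓ) : conjCommutator S T ℓ = ⊤ := by
  have key : ∀ n, 2 ^ n ≤ Nat.card (conjCommutator S T n) ∨ conjCommutator S T n = ⊤ := by
    intro n
    induction n with
    | zero => exact Or.inl (by simpa using Nat.one_le_iff_ne_zero.2 Nat.card_pos.ne')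
    | succ n ih =>
      have hle := conjCommutator_mono h1 T n
      rcases ih with ih | ih
      · by_cases heq : conjCommutator S T n = conjCommutator S T (n + 1)
        · right
          rw [← heq]
          have hnorm : (conjCommutator S T n).Normal := by
            rw [← Subgroup.normalizer_eq_top_iff, ← top_le_iff, ← hgen, Subgroup.closure_le]
            intro a ha
            have hconj : ∀ a ∈ S, ∀ x ∈ conjCommutator S T n,
                a * x * a⁻¹ ∈ conjCommutator S T n := fun a ha x hx => by
              rw [heq]
              exact conj_mem_conjCommutator ha hx
            refine Subgroup.mem_normalizer_iff.2 fun x => ⟨hconj a ha x, fun hx => ?_⟩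
            have := hconj a⁻¹ (by rw [← hS]; exact Finset.inv_mem_inv ha) _ hx
            simpa [mul_assoc] using this
          refine hnorm.eq_bot_or_eq_top.resolve_left fun hbot => ?_
          obtain ⟨a, b, hab⟩ := hG
          have hcomm : ∀ s ∈ T, ∀ t ∈ T, s * t = t * s := by
            intro s hs t ht
            have : (1 : G) * (s * t * s⁻¹ * t⁻¹) * 1⁻¹ ∈ conjCommutator S T n :=
              Subgroup.subset_closure ⟨1, one_mem_pow h1 n, s, hs, t, ht, rfl⟩
            rwa [hbot, Subgroup.mem_bot, one_mul, inv_one, mul_one, mul_inv_eq_one,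
              mul_inv_eq_iff_eq_mul] at this
          have hc := Subgroup.isMulCommutative_closure hcomm
          rw [hT] at hc
          have := hc.is_comm.comm ⟨a, trivial⟩ ⟨b, trivial⟩
          exact hab (congrArg Subtype.val this)
        · left
          obtain ⟨k, hk⟩ := Subgroup.card_dvd_of_le hle
          have hlt : Nat.card (conjCommutator S T n) < Nat.card (conjCommutator S T (n + 1)) := by
            refine lt_of_le_of_ne (Subgroup.card_le_of_le hle) fun h => heq ?_
            exact Subgroup.eq_of_le_of_card_ge hle h.ge
          have hk2 : 2 ≤ k := by
            by_contra! hk'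
            interval_cases k <;> omega
          rw [hk, pow_succ]
          exact Nat.mul_le_mul ih hk2
      · exact Or.inr (top_le_iff.1 (ih ▸ hle))
  refine (key ℓ).resolve_left fun h => ?_
  have := Subgroup.card_le_card_group (conjCommutator S T ℓ)
  omega

end Generation

namespace NearSpan

variable {E : Type*} [NormedAddCommGroup E] [NormedSpace ℝ E] {m : ℕ} {b : Fin m → E}
  {a a' e e' : ℝ} {u v : E}

theorem mono (h : NearSpan b a e u) (ha : a ≤ a') (he : e ≤ e') : NearSpan b a' e' u := by
  obtain ⟨c, hc, hu⟩ := h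
  exact ⟨c, fun i => (hc i).trans ha, hu.trans he⟩

theorem sub (hu : NearSpan b a e u) (hv : NearSpan b a' e' v) :
    NearSpan b (a + a') (e + e') (u - v) := by
  obtain ⟨c, hc, hu⟩ := hu
  obtain ⟨d, hd, hv⟩ := hv
  refine ⟨c - d, fun i => (abs_sub _ _).trans (add_le_add (hc i) (hd i)), ?_⟩
  have : u - v - ∑ i, (c - d) i • b i = (u - ∑ i, c i • b i) - (v - ∑ i, d i • b i) := by
    simp only [Pi.sub_apply, sub_smul, Finset.sum_sub_distrib]
    abel
  rw [this]
  exact (norm_sub_le _ _).trans (add_le_add hu hv)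

theorem norm_le (h : NearSpan b a e u) (hb : ∀ i, ‖b i‖ ≤ 1) {M : ℝ} (hm : (m : ℝ) ≤ M)
    (ha : 0 ≤ a) : ‖u‖ ≤ M * a + e := by
  obtain ⟨c, hc, hu⟩ := h
  have h1 : ‖∑ i, c i • b i‖ ≤ m * a := by
    calc ‖∑ i, c i • b i‖ ≤ ∑ _i : Fin m, a := norm_sum_le_of_le _ fun i _ => by
          rw [norm_smul, Real.norm_eq_abs]
          exact (mul_le_of_le_one_right (abs_nonneg _) (hb i)).trans (hc i)
      _ = m * a := by simp
  calc ‖u‖ = ‖∑ i, c i • b i + (u - ∑ i, c i • b i)‖ := by rw [add_sub_cancel]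
    _ ≤ m * a + e := (norm_add_le _ _).trans (add_le_add h1 hu)
    _ ≤ M * a + e := by gcongr

theorem map (h : NearSpan b a e u) (T : E →ₗ[ℝ] E) {κ M : ℝ} (hκ : ∀ v, ‖T v‖ ≤ κ * ‖v‖)
    (hκ0 : 0 ≤ κ) (hT : ∀ i, NearSpan b a' e' (T (b i))) (hm : (m : ℝ) ≤ M) (ha : 0 ≤ a)
    (ha' : 0 ≤ a') (he' : 0 ≤ e') : NearSpan b (M * a * a') (M * a * e' + κ * e) (T u) := by
  obtain ⟨c, hc, hu⟩ := h
  choose d hd hTd using hT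
  refine ⟨fun j => ∑ i, c i * d i j, fun j => ?_, ?_⟩
  · calc |∑ i, c i * d i j| ≤ ∑ _i : Fin m, a * a' := by
          refine (Finset.abs_sum_le_sum_abs _ _).trans (Finset.sum_le_sum fun i _ => ?_)
          rw [abs_mul]
          exact mul_le_mul (hc i) (hd i j) (abs_nonneg _) ha
      _ = m * a * a' := by simp [mul_assoc]
      _ ≤ M * a * a' := by gcongr
  · have heq : T u - ∑ j, (∑ i, c i * d i j) • b j =
        ∑ i, c i • (T (b i) - ∑ j, d i j • b j) + T (u - ∑ i, c i • b i) := by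
      simp only [map_sub, map_sum, map_smul, smul_sub, Finset.smul_sum, Finset.sum_sub_distrib,
        Finset.sum_smul, smul_smul]
      rw [Finset.sum_comm]
      abel
    rw [heq]
    refine (norm_add_le _ _).trans (add_le_add ?_ ((hκ _).trans (by gcongr)))
    calc ‖∑ i, c i • (T (b i) - ∑ j, d i j • b j)‖ ≤ ∑ _i : Fin m, a * e' :=
          norm_sum_le_of_le _ fun i _ => by
            rw [norm_smul, Real.norm_eq_abs]
            exact mul_le_mul (hc i) (hTd i) (norm_nonneg _) ha
      _ = m * a * e' := by simp [mul_assoc]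
      _ ≤ M * a * e' := by gcongr

end NearSpan

section ApproximateRepresentation

variable {G : Type*} [Group G] {E : Type*} [NormedAddCommGroup E] [NormedSpace ℝ E]

/-- The element `x` moves every vector `b i` to within an approximate combination of the `b j`
with coefficients at most `η`, up to an error `e`. -/
def NearlyFixes (π : Representation ℝ G E) {m : ℕ} (b : Fin m → E) (η e : ℝ) (x : G) : Prop :=
  ∀ i, NearSpan b η e (π x (b i) - b i)

variable {π : Representation ℝ G E} {m : ℕ} {b : Fin m → E}

theorem norm_representation_sub_le (hπ : ∀ x u, ‖π x u‖ = ‖u‖) (x : G) (u : E) :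
    ‖(π x - 1) u‖ ≤ 2 * ‖u‖ := by
  have := norm_sub_le (π x u) u
  rw [hπ] at this
  simp only [LinearMap.sub_apply, Module.End.one_apply]
  linarith

theorem NearlyFixes.nearSpan_sub (hπ : ∀ x u, ‖π x u‖ = ‖u‖) {η e K e₀ M : ℝ} {x : G}
    (hx : NearlyFixes π b η e x) {u : E} (hu : NearSpan b K e₀ u) (hm : (m : ℝ) ≤ M) (hK : 0 ≤ K)
    (hη : 0 ≤ η) (he : 0 ≤ e) : NearSpan b (M * K * η) (M * K * e + 2 * e₀) (π x u - u) :=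
  hu.map (π x - 1) (norm_representation_sub_le hπ x) zero_le_two hx hm hK hη he

theorem NearlyFixes.conj_commutator (hπ : ∀ x u, ‖π x u‖ = ‖u‖) {M K e₀ η e : ℝ} (hM : 1 ≤ M)
    (hm : (m : ℝ) ≤ M) (hK : 1 ≤ K) (he₀ : 0 ≤ e₀) (he : e₀ ≤ e) (hη : 0 ≤ η) (hη1 : η ≤ 1)
    {g s t : G} (hs : NearlyFixes π b η e s) (ht : NearlyFixes π b η e t)
    (hg : ∀ i, NearSpan b K e₀ (π g (b i)))
    (hw : ∀ i, NearSpan b K e₀ (π (s⁻¹ * t⁻¹ * g⁻¹) (b i))) :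
    NearlyFixes π b (16 * M ^ 3 * K ^ 2 * η ^ 2) (16 * M ^ 3 * K ^ 2 * e)
      (g * (s * t * s⁻¹ * t⁻¹) * g⁻¹) := by
  intro i
  have he0 : 0 ≤ e := he₀.trans he
  have hMK : 1 ≤ M * K := one_le_mul_of_one_le_of_one_le hM hK
  set u := π (s⁻¹ * t⁻¹ * g⁻¹) (b i) with hu
  have heq : π (g * (s * t * s⁻¹ * t⁻¹) * g⁻¹) (b i) - b i =
      π g ((π s (π t u - u) - (π t u - u)) - (π t (π s u - u) - (π s u - u))) := by
    have h1 : π (g * (s * t * s⁻¹ * t⁻¹) * g⁻¹) (b i) = π g (π s (π t u)) := by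
      rw [hu]
      simp only [← Module.End.mul_apply, ← map_mul]
      congr 2
      group
    have h2 : b i = π g (π t (π s u)) := by
      rw [hu]
      simp only [← Module.End.mul_apply, ← map_mul]
      have : g * (t * (s * (s⁻¹ * t⁻¹ * g⁻¹))) = 1 := by group
      rw [this, map_one, Module.End.one_apply]
    rw [h1]
    nth_rewrite 1 [h2]
    simp only [map_sub]
    abel
  rw [heq]
  have step : ∀ x y : G, NearlyFixes π b η e x → NearlyFixes π b η e y →
      NearSpan b (M ^ 2 * K * η ^ 2) (7 * M ^ 2 * K * e) (π x (π y u - u) - (π y u - u)) := by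
    intro x y hx hy
    refine (hx.nearSpan_sub hπ (hy.nearSpan_sub hπ (hw i) hm (by linarith) hη he0) hm (by positivity)
      hη he0).mono (le_of_eq (by ring)) ?_
    have h1 : M * (M * K * η) * e ≤ M ^ 2 * K * e := by
      have : M * (M * K * η) * e = (M ^ 2 * K * e) * η := by ring
      rw [this]
      exact mul_le_of_le_one_right (by positivity) hη1
    have h2 : M * K * e ≤ M ^ 2 * K * e := by
      have : M ≤ M ^ 2 := by nlinarith
      gcongr
    have h3 : e₀ ≤ M * K * e := he.trans (le_mul_of_one_le_left he0 hMK)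
    linarith
  have hdiff := (step s t hs ht).sub (step t s ht hs)
  refine (hdiff.map (π g) (κ := 1) (fun v => by rw [hπ, one_mul]) zero_le_one hg hm (by positivity)
    (by linarith) he₀).mono ?_ ?_
  · have : 0 ≤ M ^ 3 * K ^ 2 * η ^ 2 := by positivity
    calc _ = 2 * (M ^ 3 * K ^ 2 * η ^ 2) := by ring
      _ ≤ 16 * (M ^ 3 * K ^ 2 * η ^ 2) := by linarith
      _ = _ := by ring
  · have h1 : M ^ 3 * K * η ^ 2 * e₀ ≤ M ^ 3 * K ^ 2 * e := by
      calc M ^ 3 * K * η ^ 2 * e₀ ≤ M ^ 3 * K * 1 * e := by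
            have : η ^ 2 ≤ 1 := pow_le_one₀ hη hη1
            gcongr
        _ = M ^ 3 * K * e * 1 := by ring
        _ ≤ M ^ 3 * K * e * K := by gcongr
        _ = _ := by ring
    have h2 : M ^ 2 * K * e ≤ M ^ 3 * K ^ 2 * e := by
      have : M ^ 3 * K ^ 2 * e = (M ^ 2 * K * e) * (M * K) := by ring
      rw [this]
      exact le_mul_of_one_le_right (by positivity) hMK
    calc _ = 2 * (M ^ 3 * K * η ^ 2 * e₀) + 14 * (M ^ 2 * K * e) := by ring
      _ ≤ 16 * (M ^ 3 * K ^ 2 * e) := by linarith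
      _ = _ := by ring

variable [DecidableEq G] [Finite G] [IsSimpleGroup G] {S : Finset G}

/-- Short elements that nearly fix an approximately invariant family generate the group. -/
theorem closure_nearlyFixes_eq_top (hπ : ∀ x u, ‖π x u‖ = ‖u‖) (hS : S⁻¹ = S) (h1 : (1 : G) ∈ S)
    (hgen : Subgroup.closure (S : Set G) = ⊤) {M K e₀ η : ℝ} (hM : 1 ≤ M) (hm : (m : ℝ) ≤ M)
    (hK : 1 ≤ K) (he₀ : 0 ≤ e₀) (hη : 0 < η) (hη1 : η ≤ 1) {r Q X : ℕ}
    (hb : ∀ y ∈ S ^ r, ∀ i, NearSpan b K e₀ (π y (b i))) (hX : K / η ≤ X)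
    (hQ : (2 * X + 1) ^ (m * m) ≤ Q) (hQr : Q ≤ r) (hG : Q.factorial < Nat.card G) :
    Subgroup.closure {z | z ∈ S ^ (2 * Q) ∧ NearlyFixes π b (M * K * η) (3 * M * e₀) z} = ⊤ := by
  choose! c hc hcb using hb
  refine Subgroup.eq_top_of_index_le (Q := Q) ?_ hG
  refine Subgroup.index_le_of_maps_to h1 hgen
    (Fintype.piFinset fun _ : Fin m × Fin m => Finset.Icc (-(X : ℤ)) X) ?_
    (fun y p => ⌊c y p.1 p.2 / η⌋) ?_ ?_
  · refine le_trans (le_of_eq ?_) hQ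
    rw [Fintype.card_piFinset]
    simp only [Int.card_Icc, Finset.prod_const, Finset.card_univ, Fintype.card_prod, Fintype.card_fin]
    congr 1
    omega
  · intro y hy
    rw [Fintype.mem_piFinset]
    intro p
    have h2 := hc y (mem_pow_of_le h1 hQr hy) p.1 p.2
    have h3 : |c y p.1 p.2 / η| ≤ X := by
      rw [abs_div, abs_of_pos hη]
      exact (div_le_div_of_nonneg_right h2 hη.le).trans hX
    rw [abs_le] at h3
    rw [Finset.mem_Icc]
    constructor
    · rw [Int.le_floor]
      exact_mod_cast h3.1
    · exact_mod_cast (Int.floor_le _).trans h3.2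
  · intro x hx y hy hxy
    have hxr := mem_pow_of_le h1 hQr hx
    have hyr := mem_pow_of_le h1 hQr hy
    refine Subgroup.subset_closure ⟨?_, fun i => ?_⟩
    · rw [two_mul]
      exact mul_mem_pow_add (inv_mem_pow_of_symm hS hx) hy
    · have hd : NearSpan b η (2 * e₀) (π y (b i) - π x (b i)) := by
        refine ⟨c y i - c x i, fun j => ?_, ?_⟩
        · have := Int.abs_sub_lt_one_of_floor_eq_floor (congrFun hxy (i, j)).symm
          rw [← sub_div, abs_div, abs_of_pos hη, div_lt_one hη] at this
          exact this.le
        · have h2 : π y (b i) - π x (b i) - ∑ j, (c y i - c x i) j • b j =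
              (π y (b i) - ∑ j, c y i j • b j) - (π x (b i) - ∑ j, c x i j • b j) := by
            simp only [Pi.sub_apply, sub_smul, Finset.sum_sub_distrib]
            abel
          rw [h2, two_mul]
          exact (norm_sub_le _ _).trans (add_le_add (hcb y hyr i) (hcb x hxr i))
      have heq : π (x⁻¹ * y) (b i) - b i = π x⁻¹ (π y (b i) - π x (b i)) := by
        rw [map_sub, ← Module.End.mul_apply, ← Module.End.mul_apply, ← map_mul, ← map_mul,
          inv_mul_cancel, map_one, Module.End.one_apply]
      rw [heq]
      have hinv : ∀ j, NearSpan b K e₀ (π x⁻¹ (b j)) := fun j =>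
        ⟨c x⁻¹ j, hc _ (inv_mem_pow_of_symm hS hxr) j, hcb _ (inv_mem_pow_of_symm hS hxr) j⟩
      refine (hd.map (π x⁻¹) (κ := 1) (fun v => by rw [hπ, one_mul]) zero_le_one hinv hm hη.le
        (by linarith) he₀).mono (le_of_eq (by ring)) ?_
      have h2 : M * η * e₀ ≤ M * 1 * e₀ := by gcongr
      have h3 : e₀ ≤ M * e₀ := le_mul_of_one_le_left he₀ hM
      linarith

/-- Repeated commutators produce generating sets of short elements which fix an approximately
invariant family up to a rapidly decreasing error. -/
theorem closure_nearlyFixes_iterate_eq_top (hπ : ∀ x u, ‖π x u‖ = ‖u‖) (hS : S⁻¹ = S)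
    (h1 : (1 : G) ∈ S) (hgen : Subgroup.closure (S : Set G) = ⊤) (hG : ∃ a b : G, a * b ≠ b * a)
    {M K e₀ P : ℝ} (hM : 1 ≤ M) (hm : (m : ℝ) ≤ M) (hK : 1 ≤ K) (he₀ : 0 ≤ e₀)
    (hP : P = 16 * M ^ 3 * K ^ 2) {r Q X ℓ Λ : ℕ}
    (hb : ∀ y ∈ S ^ r, ∀ i, NearSpan b K e₀ (π y (b i))) (hX : 2 * P * M * K ^ 2 ≤ X)
    (hQ : (2 * X + 1) ^ (m * m) ≤ Q) (hcard : Q.factorial < Nat.card G)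
    (hℓ : Nat.card G < 2 ^ ℓ) (hQΛ : 2 * Q ≤ Λ) (hℓΛ : 2 * ℓ ≤ Λ) {h : ℕ} (hr : 5 ^ h * Λ ≤ r) :
    Subgroup.closure {z | z ∈ S ^ (5 ^ h * Λ) ∧
      NearlyFixes π b (P⁻¹ * (2⁻¹) ^ (2 ^ h)) (P ^ h * (3 * M * e₀)) z} = ⊤ := by
  have hP1 : 1 ≤ P := by
    have h2 : 1 ≤ M ^ 3 * K ^ 2 := one_le_mul_of_one_le_of_one_le (one_le_pow₀ hM) (one_le_pow₀ hK)
    rw [hP]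
    linarith
  have hP0 : 0 < P := by linarith
  induction h with
  | zero =>
    have hMK : 1 ≤ M * K := one_le_mul_of_one_le_of_one_le hM hK
    have hη : M * K * (2 * P * M * K)⁻¹ = P⁻¹ * (2⁻¹) ^ (2 ^ 0) := by
      have : M ≠ 0 := by positivity
      have : K ≠ 0 := by positivity
      field_simp
      norm_num
    rw [← top_le_iff]
    refine le_trans (top_le_iff.2 (closure_nearlyFixes_eq_top (b := b) hπ hS h1 hgen hM hm hK he₀
      (η := (2 * P * M * K)⁻¹) (by positivity) ?_ hb (X := X) ?_ hQ ?_ hcard))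
      (Subgroup.closure_mono ?_)
    · refine inv_le_one_of_one_le₀ ?_
      have : 1 ≤ P * (M * K) := one_le_mul_of_one_le_of_one_le hP1 hMK
      linarith
    · rw [div_inv_eq_mul]
      refine le_trans (le_of_eq ?_) hX
      ring
    · simp only [pow_zero, one_mul] at hr
      omega
    · rintro z ⟨hz, hz'⟩
      rw [hη] at hz'
      refine ⟨mem_pow_of_le h1 (by simpa using hQΛ) hz, ?_⟩
      simpa using hz'
  | succ h ih =>
    have h5 : 5 ^ (h + 1) * Λ = 5 * (5 ^ h * Λ) := by ring
    have hΛ : Λ ≤ 5 ^ h * Λ := Nat.le_mul_of_pos_left _ (by positivity)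
    have hT := ih (by omega)
    rw [← top_le_iff, ← conjCommutator_eq_top hS h1 hgen hG hT hℓ]
    refine Subgroup.closure_mono ?_
    rintro x ⟨g, hg, s, ⟨hs, hs'⟩, t, ⟨ht, ht'⟩, rfl⟩
    have hgi := inv_mem_pow_of_symm hS hg
    have hsi := inv_mem_pow_of_symm hS hs
    have hti := inv_mem_pow_of_symm hS ht
    refine ⟨?_, ?_⟩
    · refine mem_pow_of_le h1 ?_ (mul_mem_pow_add (mul_mem_pow_add hg
        (mul_mem_pow_add (mul_mem_pow_add (mul_mem_pow_add hs ht) hsi) hti)) hgi)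
      omega
    · have hη1 : P⁻¹ * (2⁻¹ : ℝ) ^ (2 ^ h) ≤ 1 :=
        mul_le_one₀ (inv_le_one_of_one_le₀ hP1) (by positivity)
          (pow_le_one₀ (by norm_num) (by norm_num))
      have hPh : 1 ≤ P ^ h := one_le_pow₀ hP1
      have key := hs'.conj_commutator hπ hM hm hK he₀ (e := P ^ h * (3 * M * e₀)) ?_
        (by positivity) hη1 ht' (hb g (mem_pow_of_le h1 (by omega) hg))
        (hb _ (mem_pow_of_le h1 (by omega) (mul_mem_pow_add (mul_mem_pow_add hsi hti) hgi)))
      · rw [← hP] at key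
        have e1 : P * (P⁻¹ * (2⁻¹ : ℝ) ^ (2 ^ h)) ^ 2 = P⁻¹ * (2⁻¹) ^ (2 ^ (h + 1)) := by
          rw [pow_succ 2 h, pow_mul]
          field_simp
        have e2 : P * (P ^ h * (3 * M * e₀)) = P ^ (h + 1) * (3 * M * e₀) := by ring
        rwa [e1, e2] at key
      · have h3 : 1 ≤ P ^ h * (3 * M) := one_le_mul_of_one_le_of_one_le hPh (by linarith)
        calc e₀ ≤ P ^ h * (3 * M) * e₀ := le_mul_of_one_le_left he₀ h3
          _ = _ := by ring

end ApproximateRepresentation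

section BallWeight

variable {G : Type*} [Group G] [Fintype G]

theorem norm_leftTranslation (x : G) (f : G → ℝ) : ‖leftTranslation G x f‖ = ‖f‖ := by
  have key : ∀ (x : G) (f : G → ℝ), ‖leftTranslation G x f‖ ≤ ‖f‖ := fun x f =>
    (pi_norm_le_iff_of_nonneg (norm_nonneg _)).2 fun g => norm_le_pi_norm f (x⁻¹ * g)
  refine le_antisymm (key x f) ?_
  have := key x⁻¹ (leftTranslation G x f)
  rwa [← Module.End.mul_apply, ← map_mul, inv_mul_cancel, map_one, Module.End.one_apply] at this

variable [DecidableEq G] {S : Finset G}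

/-- A weight supported on a proper ball cannot be almost invariant under a generating set. -/
theorem IsBallWeight.one_le_card_sq_mul {ρ : ℕ} {w : G → ℝ} (hw : IsBallWeight S ρ w)
    (hρ : S ^ ρ ≠ Finset.univ) {T : Set G} (hT : Subgroup.closure T = ⊤) {σ : ℝ} (hσ0 : 0 ≤ σ)
    (hσ : ∀ z ∈ T, ‖leftTranslation G z w - w‖ ≤ σ) : 1 ≤ (Fintype.card G : ℝ) ^ 2 * σ := by
  classical
  set U : Finset G := insert 1 T.toFinset with hU
  have hUgen : Subgroup.closure (U : Set G) = ⊤ := by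
    rw [← top_le_iff, ← hT]
    exact Subgroup.closure_mono fun z hz => by simp [hU, hz]
  have hUσ : ∀ z ∈ U, ‖leftTranslation G z w - w‖ ≤ σ := by
    intro z hz
    rcases Finset.mem_insert.1 hz with rfl | hz
    · simpa using hσ0
    · exact hσ z (Set.mem_toFinset.1 hz)
  have hpow : ∀ n : ℕ, ∀ g ∈ U ^ n, ‖leftTranslation G g w - w‖ ≤ n * σ := by
    intro n
    induction n with
    | zero => simp
    | succ n ih =>
      intro g hg
      rw [pow_succ'] at hg
      obtain ⟨z, hz, y, hy, rfl⟩ := Finset.mem_mul.1 hg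
      have heq : leftTranslation G (z * y) w - w =
          leftTranslation G z (leftTranslation G y w - w) + (leftTranslation G z w - w) := by
        rw [map_mul, Module.End.mul_apply, map_sub]
        abel
      rw [heq]
      refine (norm_add_le _ _).trans ?_
      rw [norm_leftTranslation]
      have := ih y hy
      have := hUσ z hz
      push_cast
      linarith
  obtain ⟨g₁, hg₁⟩ : ∃ g₁, g₁ ∉ S ^ ρ := by
    by_contra! h
    exact hρ (Finset.eq_univ_of_forall h)
  have hw₁ : w g₁ = 0 := by
    by_contra h
    exact hg₁ (hw.mem_of_ne_zero g₁ h)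
  obtain ⟨g₀, -, hg₀⟩ : ∃ g₀ ∈ Finset.univ, (Fintype.card G : ℝ)⁻¹ ≤ w g₀ := by
    refine Finset.exists_le_of_sum_le Finset.univ_nonempty ?_
    rw [hw.sum_eq_one]
    simp
  have hcard : (0 : ℝ) < Fintype.card G := by exact_mod_cast Fintype.card_pos
  have h1 := hpow (Fintype.card G) (g₁ * g₀⁻¹) (by
    rw [pow_card_eq_univ_of_closure_eq_top (Finset.mem_insert_self _ _) hUgen]
    exact Finset.mem_univ _)
  have h2 := norm_le_pi_norm (leftTranslation G (g₁ * g₀⁻¹) w - w) g₁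
  simp only [Pi.sub_apply, leftTranslation_apply, hw₁, sub_zero, mul_inv_rev, inv_inv,
    inv_mul_cancel_right, Real.norm_eq_abs] at h2
  have h3 : (Fintype.card G : ℝ)⁻¹ ≤ Fintype.card G * σ :=
    hg₀.trans ((le_abs_self _).trans (h2.trans h1))
  calc (1 : ℝ) = Fintype.card G * (Fintype.card G : ℝ)⁻¹ := (mul_inv_cancel₀ hcard.ne').symm
    _ ≤ Fintype.card G * (Fintype.card G * σ) := by gcongr
    _ = _ := by ring

variable [IsSimpleGroup G]

/-- If a weight on a proper ball has tiny minors, the group is large in terms of the size of the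
minors. -/
theorem IsBallWeight.one_le_of_minorBound (hS : S⁻¹ = S) (h1 : (1 : G) ∈ S)
    (hgen : Subgroup.closure (S : Set G) = ⊤) (hG : ∃ a b : G, a * b ≠ b * a) {ρ : ℕ} {w : G → ℝ}
    (hw : IsBallWeight S ρ w) (hρ : S ^ ρ ≠ Finset.univ) {m₀ n R K P X Q h ℓ : ℕ} {τ c : ℝ}
    (hm₀ : 1 ≤ m₀) (hτ0 : 0 < τ) (hτ : τ ≤ 1) (hn : 1 ≤ n) (hK : 1 ≤ K) (hR : 2 ^ (2 * n) ≤ R)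
    (hmin : MinorBound S m₀ R w c) (hc : c < τ ^ m₀)
    (hKn : ((m₀.factorial : ℝ) * (τ⁻¹) ^ m₀) ^ (m₀ + 1) ≤ (K : ℝ) ^ n)
    (hP : P = 16 * m₀ ^ 3 * K ^ 2) (hX : X = 2 * P * m₀ * K ^ 2)
    (hQ : Q = (2 * X + 1) ^ (m₀ * m₀)) (hcard : Q.factorial < Fintype.card G)
    (hℓ : Fintype.card G < 2 ^ ℓ) (hh : 5 ^ h * (2 * (Q + ℓ)) ≤ 2 ^ n) :
    1 ≤ (Fintype.card G : ℝ) ^ 2 * ((2⁻¹) ^ (2 ^ h) + (P : ℝ) ^ (h + 1) * τ) := by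
  have hK' : (1 : ℝ) ≤ K := by exact_mod_cast hK
  have hm₀' : (1 : ℝ) ≤ m₀ := by exact_mod_cast hm₀
  obtain ⟨r, hr, m, hm, b, hb1, hb, hbw⟩ :=
    exists_approximate_basis h1 hw hτ0 hτ hn hK' hR hmin hc hKn
  have hm' : (m : ℝ) ≤ m₀ := by exact_mod_cast hm.le
  have hP' : (P : ℝ) = 16 * (m₀ : ℝ) ^ 3 * (K : ℝ) ^ 2 := by rw [hP]; push_cast; ring
  have hP1 : (1 : ℝ) ≤ P := by
    have h2 : 1 ≤ (m₀ : ℝ) ^ 3 * (K : ℝ) ^ 2 :=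
      one_le_mul_of_one_le_of_one_le (one_le_pow₀ hm₀') (one_le_pow₀ hK')
    rw [hP']
    linarith
  have hP0 : (0 : ℝ) < P := by linarith
  have hT := closure_nearlyFixes_iterate_eq_top (π := leftTranslation G) (b := b)
    norm_leftTranslation hS h1 hgen hG hm₀' hm' hK' (e₀ := K * τ) (by positivity) hP' hb
    (X := X) (Q := Q) (ℓ := ℓ) (Λ := 2 * (Q + ℓ)) (h := h) (by rw [hX]; push_cast; exact le_rfl)
    (by
      rw [hQ]
      exact Nat.pow_le_pow_right (by omega) (Nat.mul_le_mul hm.le hm.le))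
    (by rwa [Nat.card_eq_fintype_card]) (by rwa [Nat.card_eq_fintype_card]) (by omega) (by omega)
    (hh.trans hr)
  set η : ℝ := (P : ℝ)⁻¹ * (2⁻¹) ^ (2 ^ h) with hη
  set e : ℝ := (P : ℝ) ^ h * (3 * m₀ * (K * τ)) with he
  have hη0 : 0 ≤ η := by positivity
  have he0 : 0 ≤ e := by positivity
  have hKτ : K * τ ≤ e := by
    have h3 : 1 ≤ (P : ℝ) ^ h * (3 * m₀) :=
      one_le_mul_of_one_le_of_one_le (one_le_pow₀ hP1) (by linarith)
    calc K * τ ≤ (P : ℝ) ^ h * (3 * m₀) * (K * τ) := le_mul_of_one_le_left (by positivity) h3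
      _ = _ := by rw [he]; ring
  have hMK : (1 : ℝ) ≤ m₀ * K := one_le_mul_of_one_le_of_one_le hm₀' hK'
  refine hw.one_le_card_sq_mul hρ hT (by positivity) fun z hz => ?_
  refine ((hz.2.nearSpan_sub norm_leftTranslation hbw hm' (by positivity) hη0 he0).norm_le hb1 hm'
    (by positivity)).trans ?_
  have hmm : (m₀ : ℝ) ^ 2 ≤ (m₀ : ℝ) ^ 3 := pow_le_pow_right₀ hm₀' (by norm_num)
  have hKK : (K : ℝ) ≤ (K : ℝ) ^ 2 := le_self_pow₀ hK' (by norm_num)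
  have h1 : (m₀ : ℝ) * (m₀ * K * η) ≤ (2⁻¹) ^ (2 ^ h) := by
    have h2 : (m₀ : ℝ) ^ 2 * K ≤ P := by
      have h3 : (m₀ : ℝ) ^ 2 * K ≤ (m₀ : ℝ) ^ 3 * (K : ℝ) ^ 2 := by gcongr
      have h4 : 0 ≤ (m₀ : ℝ) ^ 3 * (K : ℝ) ^ 2 := by positivity
      rw [hP']
      linarith
    calc (m₀ : ℝ) * (m₀ * K * η) = (m₀ : ℝ) ^ 2 * K * η := by ring
      _ ≤ P * η := by gcongr
      _ = _ := by rw [hη, mul_inv_cancel_left₀ hP0.ne']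
  have h2 : (m₀ : ℝ) * K * e + 2 * (K * τ) ≤ (P : ℝ) ^ (h + 1) * τ := by
    have h3 : e ≤ m₀ * K * e := le_mul_of_one_le_left he0 hMK
    have h4 : 9 * (m₀ : ℝ) ^ 2 * (K : ℝ) ^ 2 ≤ P := by
      rw [hP']
      gcongr
      norm_num
    calc (m₀ : ℝ) * K * e + 2 * (K * τ) ≤ 3 * (m₀ * K * e) := by linarith
      _ = (P : ℝ) ^ h * (9 * (m₀ : ℝ) ^ 2 * (K : ℝ) ^ 2) * τ := by rw [he]; ring
      _ ≤ (P : ℝ) ^ h * P * τ := by gcongr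
      _ = _ := by rw [pow_succ]
  linarith

end BallWeight

section Asymptotics

theorem eventually_const_mul_pow_lt_two_pow (C : ℝ) (k : ℕ) :
    ∀ᶠ n : ℕ in Filter.atTop, C * (n : ℝ) ^ k < 2 ^ n := by
  have h := (tendsto_pow_const_div_const_pow_of_one_lt k (one_lt_two : (1 : ℝ) < 2)).const_mul C
  rw [mul_zero] at h
  filter_upwards [h.eventually_lt_const zero_lt_one] with n hn
  rwa [← mul_div_assoc, div_lt_one (by positivity)] at hn

/-- Admissible scales for the averaging process. -/
theorem exists_scale (c q : ℕ) (hq : 2 ≤ q) : ∃ b L I : ℕ, 1 ≤ b ∧ 4 ≤ L ∧ L = 2 * q * (I + 1) ∧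
    L ≤ (8 * b) ^ 4 ∧ ((L : ℝ) ^ (2 * c)) < (1 + (8 * (8 * b : ℝ))⁻¹) ^ I := by
  obtain ⟨b, hb1, hb2⟩ := ((eventually_const_mul_pow_lt_two_pow ((130 * q : ℝ) ^ (2 * c))
    (2 * (2 * c))).and (Filter.eventually_ge_atTop q)).exists
  have hb : 1 ≤ b := by omega
  have hbR : (1 : ℝ) ≤ b := by exact_mod_cast hb
  have hL : 2 * q * (64 * b ^ 2 + 1) ≤ 130 * q * b ^ 2 := by
    have : 1 ≤ b ^ 2 := Nat.one_le_pow _ _ hb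
    nlinarith
  refine ⟨b, 2 * q * (64 * b ^ 2 + 1), 64 * b ^ 2, hb, by nlinarith [Nat.zero_le (q * b ^ 2)], rfl,
    ?_, ?_⟩
  · calc 2 * q * (64 * b ^ 2 + 1) ≤ 130 * q * b ^ 2 := hL
      _ ≤ 130 * b * b ^ 2 := by gcongr
      _ ≤ 4096 * (b * b ^ 2) * b := by nlinarith [Nat.zero_le (b * b ^ 2)]
      _ = (8 * b) ^ 4 := by ring
  · have hbern : (2 : ℝ) ≤ (1 + (8 * (8 * b : ℝ))⁻¹) ^ (64 * b) := by
      have h := one_add_mul_le_pow (a := (8 * (8 * b : ℝ))⁻¹) (by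
        have : (0 : ℝ) ≤ (8 * (8 * b : ℝ))⁻¹ := by positivity
        linarith) (64 * b)
      refine le_trans (le_of_eq ?_) h
      push_cast
      field_simp
      norm_num
    calc (((2 * q * (64 * b ^ 2 + 1) : ℕ)) : ℝ) ^ (2 * c) ≤ ((130 * q * b ^ 2 : ℕ) : ℝ) ^ (2 * c) := by
          gcongr
      _ = (130 * q : ℝ) ^ (2 * c) * (b : ℝ) ^ (2 * (2 * c)) := by
          push_cast
          rw [mul_pow, ← pow_mul]
      _ < 2 ^ b := hb1
      _ ≤ ((1 + (8 * (8 * b : ℝ))⁻¹) ^ (64 * b)) ^ b := by gcongr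
      _ = (1 + (8 * (8 * b : ℝ))⁻¹) ^ (64 * b ^ 2) := by
          rw [← pow_mul]
          ring_nf

/-- A power of two comparable to `x`. -/
theorem exists_two_pow_between (x : ℕ) (hx : 2 ≤ x) : ∃ h, x ≤ 2 ^ h ∧ 2 ^ h ≤ 2 * x := by
  refine ⟨Nat.clog 2 x, Nat.le_pow_clog one_lt_two x, ?_⟩
  have h1 := Nat.pow_pred_clog_lt_self one_lt_two (by omega : 1 < x)
  have h2 : 0 < Nat.clog 2 x := Nat.clog_pos one_lt_two hx
  rw [Nat.pred_eq_sub_one] at h1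
  have h3 : 2 ^ Nat.clog 2 x = 2 * 2 ^ (Nat.clog 2 x - 1) := by
    rw [← pow_succ']
    congr 1
    omega
  omega

end Asymptotics

set_option maxHeartbeats 1000000 in
/-- For every exponent `c` there is `L` such that non-abelian finite simple groups of order at most
`L ^ (c * n)` have diameter at most `L ^ (2 * n + 1)`, when `n` and the group are large enough. -/
theorem exists_pow_eq_univ_of_card_le.{u} (c : ℕ) (hc : 1 ≤ c) : ∃ L ≥ 2, ∃ n₀ N₀ : ℕ, ∀ n ≥ n₀,
    ∀ (G : Type u) [Group G] [Fintype G] [DecidableEq G] [IsSimpleGroup G],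
      (∃ a b : G, a * b ≠ b * a) → N₀ < Fintype.card G → Fintype.card G ≤ L ^ (c * n) →
        ∀ S : Finset G, S⁻¹ = S → (1 : G) ∈ S → Subgroup.closure (S : Set G) = ⊤ →
          S ^ (L ^ (2 * n + 1)) = Finset.univ := by
  set A := 2 * c + 1 with hA
  set q := 8 * (2 * A + 1) with hq
  obtain ⟨b, L, I, hb, hL4, hL, hLb, hLI⟩ := exists_scale c q (by omega)
  set N := L ^ (2 * c) with hN
  set m₀ := 2 * N with hm₀
  set K := (m₀.factorial * L ^ (A * m₀)) ^ (m₀ + 1) with hK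
  set P := 16 * m₀ ^ 3 * K ^ 2 with hP
  set X := 2 * P * m₀ * K ^ 2 with hX
  set Q := (2 * X + 1) ^ (m₀ * m₀) with hQ
  set C := 4 * L * c + 4 with hC
  have hN1 : 1 ≤ N := Nat.one_le_pow _ _ (by omega)
  have hK1 : 1 ≤ K := Nat.one_le_pow _ _ (Nat.mul_pos (Nat.factorial_pos _) (by positivity))
  obtain ⟨n₀, hn₀⟩ := Filter.eventually_atTop.1
    ((eventually_const_mul_pow_lt_two_pow (m₀.factorial : ℝ) 0).and
      ((eventually_const_mul_pow_lt_two_pow ((C ^ 3 * (2 * (Q + L * c + 1)) : ℕ) : ℝ) 4).and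
        ((eventually_const_mul_pow_lt_two_pow ((2 * P * C ^ P : ℕ) : ℝ) P).and
          (Filter.eventually_ge_atTop 1))))
  refine ⟨L, by omega, n₀, Q.factorial, fun n hn G _ _ _ _ hG hcard hle S hS h1 hgen => ?_⟩
  obtain ⟨hE1, hE2, hE3, hn1⟩ := hn₀ n hn
  rw [pow_zero, mul_one] at hE1
  have hE2' : C ^ 3 * (2 * (Q + L * c + 1)) * n ^ 4 ≤ 2 ^ n := by exact_mod_cast hE2.le
  by_contra hρ
  have hbR : (1 : ℝ) ≤ b := by exact_mod_cast hb
  have hLR : (4 : ℝ) ≤ L := by exact_mod_cast hL4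
  have hL0 : (0 : ℝ) < L := by linarith
  obtain ⟨w, g, hg, hw, hmin⟩ := exists_ballWeight_minorBound hS h1 (c := c) (q := q) (I := I)
    (L := L) (N := N) (n := n) (a := 8 * b) hc (by omega) hL hN (by linarith)
    (by rw [hN]; push_cast; exact hLI) hle
  obtain ⟨h, hh1, hh2⟩ := exists_two_pow_between (2 * L * c * n + 2) (by omega)
  have hhC : 2 ^ h ≤ C * n := by
    refine hh2.trans ?_
    rw [hC]
    nlinarith
  have hτinv : ((((L : ℝ) ^ (A * n))⁻¹)⁻¹) = (L : ℝ) ^ (A * n) := inv_inv _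
  have hLn : (2 : ℝ) ^ n ≤ (L : ℝ) ^ n := by gcongr; linarith
  have key := hw.one_le_of_minorBound hS h1 hgen hG hρ (m₀ := m₀) (n := n) (R := L ^ n) (K := K)
    (P := P) (X := X) (Q := Q) (h := h) (ℓ := L * c * n + 1) (τ := ((L : ℝ) ^ (A * n))⁻¹)
    (by omega) (by positivity) (inv_le_one_of_one_le₀ (one_le_pow₀ (by linarith))) hn1 hK1 ?_ hmin
    ?_ ?_ hP hX hQ hcard ?_ ?_
  · have hcardR : (Fintype.card G : ℝ) ^ 2 ≤ (L : ℝ) ^ (2 * c * n) := by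
      have : (Fintype.card G : ℝ) ≤ (L : ℝ) ^ (c * n) := by exact_mod_cast hle
      calc (Fintype.card G : ℝ) ^ 2 ≤ ((L : ℝ) ^ (c * n)) ^ 2 := by gcongr
        _ = _ := by rw [← pow_mul]; ring_nf
    have t1 : (L : ℝ) ^ (2 * c * n) * (2⁻¹) ^ (2 ^ h) ≤ 4⁻¹ := by
      have h2 : (L : ℝ) ^ (2 * c * n) ≤ 2 ^ (2 * L * c * n) := by
        have : (L : ℝ) ≤ 2 ^ L := by exact_mod_cast Nat.lt_two_pow_self.le
        calc (L : ℝ) ^ (2 * c * n) ≤ (2 ^ L) ^ (2 * c * n) := by gcongr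
          _ = _ := by rw [← pow_mul]; ring_nf
      calc (L : ℝ) ^ (2 * c * n) * (2⁻¹) ^ (2 ^ h) ≤
            2 ^ (2 * L * c * n) * (2⁻¹) ^ (2 * L * c * n + 2) := by
            refine mul_le_mul h2 (pow_le_pow_of_le_one (by norm_num) (by norm_num) hh1)
              (by positivity) (by positivity)
        _ = 4⁻¹ := by
            rw [pow_add, ← mul_assoc, ← mul_pow]
            norm_num
    have t2 : (L : ℝ) ^ (2 * c * n) * ((P : ℝ) ^ (h + 1) * ((L : ℝ) ^ (A * n))⁻¹) < 2⁻¹ := by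
      have h2 : (P : ℝ) ^ h ≤ ((C : ℝ) * n) ^ P := by
        calc (P : ℝ) ^ h ≤ (2 ^ P) ^ h := by
              have : (P : ℝ) ≤ 2 ^ P := by exact_mod_cast Nat.lt_two_pow_self.le
              gcongr
          _ = (2 ^ h) ^ P := by rw [← pow_mul, ← pow_mul, mul_comm]
          _ ≤ _ := by
              have : (2 : ℝ) ^ h ≤ (C : ℝ) * n := by exact_mod_cast hhC
              gcongr
      have h3 : (L : ℝ) ^ (A * n) = (L : ℝ) ^ (2 * c * n) * (L : ℝ) ^ n := by
        rw [← pow_add, hA]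
        ring_nf
      have h4 : (L : ℝ) ^ (2 * c * n) * ((P : ℝ) ^ (h + 1) * ((L : ℝ) ^ (A * n))⁻¹) =
          (P : ℝ) ^ (h + 1) / (L : ℝ) ^ n := by
        rw [h3]
        field_simp
      rw [h4, div_lt_iff₀ (by positivity)]
      have h5 : 2 * (P : ℝ) ^ (h + 1) < 2 ^ n := by
        refine lt_of_le_of_lt ?_ hE3
        calc 2 * (P : ℝ) ^ (h + 1) = 2 * P * (P : ℝ) ^ h := by ring
          _ ≤ 2 * P * ((C : ℝ) * n) ^ P := by gcongr
          _ = _ := by push_cast; rw [mul_pow]; ring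
      linarith
    have t0 : 0 ≤ (2⁻¹ : ℝ) ^ (2 ^ h) + (P : ℝ) ^ (h + 1) * ((L : ℝ) ^ (A * n))⁻¹ := by positivity
    have t3 := key.trans (mul_le_mul_of_nonneg_right hcardR t0)
    rw [mul_add] at t3
    linarith
  · rw [pow_mul]
    exact Nat.pow_le_pow_left (by omega) n
  · have h2 : ((8 * (b : ℝ))⁻¹ ^ (N * q)) ^ g ≤ ((L : ℝ) ^ (N * (2 * A + 1) * n))⁻¹ := by
      rw [inv_pow, inv_pow]
      refine inv_anti₀ (by positivity) ?_
      have hLb' : (L : ℝ) ≤ (8 * b : ℝ) ^ 4 := by exact_mod_cast hLb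
      calc (L : ℝ) ^ (N * (2 * A + 1) * n) ≤ (L : ℝ) ^ (N * (2 * A + 1) * (2 * g)) := by
            gcongr
            linarith
        _ ≤ ((8 * b : ℝ) ^ 4) ^ (N * (2 * A + 1) * (2 * g)) := by gcongr
        _ = _ := by rw [← pow_mul, ← pow_mul, hq]; ring_nf
    have h3 : (m₀.factorial : ℝ) < (L : ℝ) ^ (N * n) := by
      calc (m₀.factorial : ℝ) < 2 ^ n := hE1
        _ ≤ (L : ℝ) ^ n := hLn
        _ ≤ (L : ℝ) ^ (N * n) := pow_le_pow_right₀ (by linarith) (Nat.le_mul_of_pos_left _ hN1)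
    calc _ ≤ ((L : ℝ) ^ (N * (2 * A + 1) * n))⁻¹ * m₀.factorial := by gcongr
      _ < ((L : ℝ) ^ (N * (2 * A + 1) * n))⁻¹ * (L : ℝ) ^ (N * n) := by gcongr
      _ = (((L : ℝ) ^ (A * n))⁻¹) ^ m₀ := by
          rw [inv_pow, ← pow_mul, inv_mul_eq_iff_eq_mul₀ (by positivity),
            eq_mul_inv_iff_mul_eq₀ (by positivity), ← pow_add, hm₀]
          ring_nf
  · rw [hτinv, hK]
    push_cast
    rw [← pow_mul _ (m₀ + 1) n, mul_comm (m₀ + 1) n, pow_mul _ n (m₀ + 1)]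
    refine pow_le_pow_left₀ (by positivity) ?_ _
    have h2 : (m₀.factorial : ℝ) ≤ (m₀.factorial : ℝ) ^ n :=
      le_self_pow₀ (by exact_mod_cast Nat.factorial_pos m₀) (by omega)
    rw [mul_pow, ← pow_mul, ← pow_mul, mul_right_comm A m₀ n]
    exact mul_le_mul_of_nonneg_right h2 (by positivity)
  · calc Fintype.card G ≤ L ^ (c * n) := hle
      _ ≤ (2 ^ L) ^ (c * n) := Nat.pow_le_pow_left Nat.lt_two_pow_self.le _
      _ = 2 ^ (L * c * n) := by rw [← pow_mul, mul_assoc]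
      _ < 2 ^ (L * c * n + 1) := Nat.pow_lt_pow_right one_lt_two (Nat.lt_succ_self _)
  · calc 5 ^ h * (2 * (Q + (L * c * n + 1))) ≤ (2 ^ h) ^ 3 * (2 * ((Q + L * c + 1) * n)) := by
          refine Nat.mul_le_mul ?_ ?_
          · rw [← pow_mul, mul_comm, pow_mul]
            exact Nat.pow_le_pow_left (by norm_num) h
          · have h2 : Q ≤ Q * n := Nat.le_mul_of_pos_right Q hn1
            rw [add_mul, add_mul, one_mul]
            exact Nat.mul_le_mul_left 2 (by omega)
      _ ≤ (C * n) ^ 3 * (2 * ((Q + L * c + 1) * n)) :=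
          Nat.mul_le_mul_right _ (Nat.pow_le_pow_left hhC 3)
      _ = C ^ 3 * (2 * (Q + L * c + 1)) * n ^ 4 := by ring
      _ ≤ 2 ^ n := hE2'

/-- **Diameter bound for finite simple groups** (Breuillard–Tointon). For every `ε > 0`
there is `N(ε)` such that every non-abelian finite simple group `G` with a symmetric
generating set `S` containing the identity and `diam_S(G) ≥ |G|^ε` satisfies
`|G| ≤ N(ε)`. -/
theorem finitely_many_simple_groups_with_large_diameter :
    ∀ ε : ℝ, 0 < ε → ∃ N : ℕ,
      ∀ (G : Type*) [Group G] [Finite G] [DecidableEq G], IsSimpleGroup G →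
        (∃ a b : G, a * b ≠ b * a) →
        ∀ S : Finset G, S⁻¹ = S → (1 : G) ∈ S →
          Subgroup.closure (S : Set G) = ⊤ →
          (Nat.card G : ℝ) ^ ε ≤ (groupDiam (S : Set G) : ℝ) →
          Nat.card G ≤ N := by
  intro ε hε
  set c := ⌈5 / ε⌉₊ with hc
  have hc1 : 1 ≤ c := Nat.one_le_ceil_iff.2 (by positivity)
  obtain ⟨L, hL, n₀, N₀, hmain⟩ := exists_pow_eq_univ_of_card_le c hc1
  refine ⟨max N₀ (L ^ (c * (n₀ + 1))), fun G _ _ _ hsimple hG S hS h1 hgen hdiam => ?_⟩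
  have := Fintype.ofFinite G
  rw [Nat.card_eq_fintype_card] at hdiam ⊢
  by_contra! hbig
  rw [max_lt_iff] at hbig
  set D := groupDiam (S : Set G) with hD
  have hL1 : (1 : ℝ) < L := by exact_mod_cast hL
  have hbound : ∀ n ≥ 1, D ≤ L ^ (2 * n + 3) → Fintype.card G ≤ L ^ (c * n) := by
    intro n hn hDn
    have h2 : (Fintype.card G : ℝ) ^ ε ≤ (((L : ℝ) ^ (c * n)) ^ ε) := by
      calc (Fintype.card G : ℝ) ^ ε ≤ D := hdiam
        _ ≤ (L : ℝ) ^ (2 * n + 3) := by exact_mod_cast hDn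
        _ ≤ (L : ℝ) ^ (5 * n) := pow_le_pow_right₀ hL1.le (by omega)
        _ = (L : ℝ) ^ (((5 * n : ℕ)) : ℝ) := (Real.rpow_natCast _ _).symm
        _ ≤ (L : ℝ) ^ (((c * n : ℕ) : ℝ) * ε) := by
            refine Real.rpow_le_rpow_of_exponent_le hL1.le ?_
            have h3 : 5 ≤ c * ε := (div_le_iff₀ hε).1 (Nat.le_ceil _)
            push_cast
            nlinarith [(Nat.cast_nonneg n : (0 : ℝ) ≤ n)]
        _ = _ := by rw [Real.rpow_mul (by linarith), Real.rpow_natCast]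
    exact_mod_cast (Real.rpow_le_rpow_iff (by positivity) (by positivity) hε).1 h2
  obtain ⟨n, hn1, hn2⟩ : ∃ n, (n = 0 ∨ L ^ (2 * n + 1) < D) ∧ D ≤ L ^ (2 * n + 3) := by
    have hex : ∃ n, D ≤ L ^ (2 * n + 3) := ⟨D, (Nat.lt_pow_self hL).le.trans
      (Nat.pow_le_pow_right (by omega) (by omega))⟩
    classical
    refine ⟨Nat.find hex, ?_, Nat.find_spec hex⟩
    rcases Nat.eq_zero_or_pos (Nat.find hex) with h | h
    · exact Or.inl h
    · have h2 := Nat.find_min hex (Nat.sub_lt h one_pos)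
      rw [not_le] at h2
      have h3 : 2 * (Nat.find hex - 1) + 3 = 2 * Nat.find hex + 1 := by omega
      rw [h3] at h2
      exact Or.inr h2
  have hn : n₀ + 1 < n := by
    by_contra! hle
    have h2 := hbound (n₀ + 1) (by omega)
      (hn2.trans (Nat.pow_le_pow_right (by omega) (by omega)))
    omega
  have hlt : L ^ (2 * n + 1) < D := hn1.resolve_left (by omega)
  refine Nat.notMem_of_lt_sInf hlt fun g => ?_
  have huniv := hmain n (by omega) G hG hbig.1 (hbound n (by omega) hn2) S hS h1 hgen
  rw [← Finset.coe_pow, huniv, Finset.coe_univ]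
  exact Set.mem_univ g
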